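/- arXiv:1712.07813 — 3 statements merged into one kernel-verified Lean document; each statement's English description precedes it below -/
import Mathlib

section
/- (Chen–McKay, Painlevé V for the auxiliary quantity.) Let n ≥ 1, α > 0, λ ∈ ℝ with α + λ + 1 > 0. Suppose on an open interval I ⊂ (0,∞) the function R_n(t) = (λ/h_n(t)) ∫₀^∞ π_n(x;t)² w(x,t)/(x+t) dx is twice continuously differentiable with R_n(t) ≠ 1, and set y_n(t) = R_n(t)/(R_n(t) − 1), assumed to satisfy y_n(t) ≠ 0 and y_n(t) ≠ 1 on I. Then y_n satisfies on I the Painlevé V equation y_n″ = ((3y_n − 1)/(2 y_n (y_n − 1))) (y_n′)² − y_n′/t + ((y_n − 1)²/(2t²)) ( α² y_n − λ²/y_n ) + (2n + 1 + α + λ) y_n / t − y_n (y_n + 1)/(2 (y_n − 1)). -/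
open MeasureTheory Set Finset

noncomputable def PVG (b μ t : ℝ) : ℝ :=
  ∫ x in Set.Ioi (0 : ℝ), (x + t) ^ μ * x ^ b * Real.exp (-x)

lemma PV_int_pow (b : ℝ) (hb : -1 < b) (c : ℝ) (m : ℕ) :
    IntegrableOn (fun x : ℝ => (x + c) ^ m * x ^ b * Real.exp (-x)) (Set.Ioi 0) := by
  have h1 : ∀ k : ℕ, IntegrableOn (fun x : ℝ => x ^ k * x ^ b * Real.exp (-x)) (Set.Ioi 0) := by
    intro k
    have := Real.GammaIntegral_convergent (s := b + k + 1) (by have : (0 : ℝ) ≤ k := Nat.cast_nonneg k; linarith)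
    refine this.congr_fun (fun x hx => ?_) measurableSet_Ioi
    have hx : 0 < x := hx
    simp only
    rw [show b + k + 1 - 1 = b + k by ring, Real.rpow_add hx, Real.rpow_natCast]
    ring
  have h2 : ∀ x : ℝ, (x + c) ^ m * x ^ b * Real.exp (-x) =
      ∑ k ∈ Finset.range (m + 1), (c ^ (m - k) * (m.choose k : ℝ)) *
        (x ^ k * x ^ b * Real.exp (-x)) := by
    intro x
    rw [add_pow, Finset.sum_mul, Finset.sum_mul]
    refine Finset.sum_congr rfl fun k _ => ?_
    ring
  simp_rw [h2]
  exact integrable_finsetSum _ fun k _ => (h1 k).const_mul _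

lemma PV_meas (b μ t : ℝ) :
    AEStronglyMeasurable (fun x : ℝ => (x + t) ^ μ * x ^ b * Real.exp (-x))
      (volume.restrict (Set.Ioi 0)) := by
  have : Measurable (fun x : ℝ => (x + t) ^ μ * x ^ b * Real.exp (-x)) := by fun_prop
  exact this.aestronglyMeasurable

lemma PV_int (b : ℝ) (hb : -1 < b) (μ t : ℝ) (ht : 0 < t) :
    IntegrableOn (fun x : ℝ => (x + t) ^ μ * x ^ b * Real.exp (-x)) (Set.Ioi 0) := by
  obtain ⟨m, hm⟩ := exists_nat_ge μ
  have hi := ((PV_int_pow b hb (t + 1) m).add ((PV_int_pow b hb 0 0).const_mul (t ^ μ)))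
  refine Integrable.mono' hi (PV_meas b μ t) ?_
  refine (ae_restrict_iff' measurableSet_Ioi).2 (Filter.Eventually.of_forall fun x hx => ?_)
  have hx : 0 < x := hx
  have hb' : 0 < x ^ b := Real.rpow_pos_of_pos hx b
  have he := Real.exp_pos (-x)
  have hp : 0 < (x + t) ^ μ := Real.rpow_pos_of_pos (by linarith) μ
  rw [Real.norm_of_nonneg (by positivity)]
  simp only [Pi.add_apply, pow_zero, one_mul]
  have key : (x + t) ^ μ ≤ (x + (t + 1)) ^ m + t ^ μ := by
    have ht' : 0 < t ^ μ := Real.rpow_pos_of_pos ht μ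
    have hm' : 0 < (x + (t + 1)) ^ m := by positivity
    rcases le_total μ 0 with h | h
    · have := Real.rpow_le_rpow_of_nonpos ht (by linarith : t ≤ x + t) h
      linarith
    · have h1 : (x + t) ^ μ ≤ (x + (t + 1)) ^ μ := Real.rpow_le_rpow (by linarith) (by linarith) h
      have h2 : (x + (t + 1)) ^ μ ≤ (x + (t + 1)) ^ (m : ℝ) :=
        Real.rpow_le_rpow_of_exponent_le (by linarith) hm
      rw [Real.rpow_natCast] at h2
      linarith
  calc (x + t) ^ μ * x ^ b * Real.exp (-x) = (x + t) ^ μ * (x ^ b * Real.exp (-x)) := by ring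
    _ ≤ ((x + (t + 1)) ^ m + t ^ μ) * (x ^ b * Real.exp (-x)) := by gcongr
    _ = _ := by ring

lemma PVG_shift (b : ℝ) (hb : -1 < b) (μ t : ℝ) (ht : 0 < t) :
    PVG (b + 1) (μ - 1) t + t * PVG b (μ - 1) t = PVG b μ t := by
  unfold PVG
  rw [← integral_const_mul, ← integral_add (PV_int _ (by linarith) _ _ ht)
    ((PV_int b hb _ _ ht).const_mul t)]
  refine setIntegral_congr_fun measurableSet_Ioi fun x hx => ?_
  have hx : 0 < x := hx
  rw [Real.rpow_add_one hx.ne', Real.rpow_sub_one (by linarith : x + t ≠ 0)]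
  have : x + t ≠ 0 := by linarith
  field_simp

lemma PVG_ibp (b : ℝ) (hb : 0 < b) (μ t : ℝ) (ht : 0 < t) :
    b * PVG (b - 1) μ t + μ * PVG b (μ - 1) t - PVG b μ t = 0 := by
  have hi1 := (PV_int (b - 1) (by linarith) μ t ht).const_mul b
  have hi2 := (PV_int b (by linarith) (μ - 1) t ht).const_mul μ
  have hi3 := (PV_int b (by linarith) μ t ht)
  have hd : ∀ x ∈ Set.Ioi (0 : ℝ), HasDerivAt (fun x : ℝ => (x + t) ^ μ * x ^ b * Real.exp (-x))
      (b * ((x + t) ^ μ * x ^ (b - 1) * Real.exp (-x)) +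
        μ * ((x + t) ^ (μ - 1) * x ^ b * Real.exp (-x)) -
        (x + t) ^ μ * x ^ b * Real.exp (-x)) x := by
    intro x hx
    have hx : 0 < x := hx
    have h1 : HasDerivAt (fun x : ℝ => (x + t) ^ μ) (1 * μ * (x + t) ^ (μ - 1)) x :=
      ((hasDerivAt_id x).add_const t).rpow_const (Or.inl (by simp; linarith))
    have h2 : HasDerivAt (fun x : ℝ => x ^ b) (1 * b * x ^ (b - 1)) x :=
      (hasDerivAt_id x).rpow_const (Or.inl hx.ne')
    have h3 : HasDerivAt (fun x : ℝ => Real.exp (-x)) (Real.exp (-x) * (-1)) x :=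
      (hasDerivAt_neg x).exp
    exact ((h1.mul h2).mul h3).congr_deriv (by simp only [Pi.mul_apply]; ring)
  have hcont : ContinuousWithinAt (fun x : ℝ => (x + t) ^ μ * x ^ b * Real.exp (-x))
      (Set.Ici 0) 0 := by
    apply ContinuousAt.continuousWithinAt
    have h1 : ContinuousAt (fun x : ℝ => (x + t) ^ μ) 0 :=
      (continuousAt_id.add continuousAt_const).rpow_const (Or.inl (by simp; linarith))
    have h2 : ContinuousAt (fun x : ℝ => x ^ b) 0 :=
      continuousAt_id.rpow_const (Or.inr hb.le)
    exact (h1.mul h2).mul (by fun_prop)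
  have hi := (hi1.add hi2).sub hi3
  have hlim := tendsto_zero_of_hasDerivAt_of_integrableOn_Ioi hd hi hi3
  have := integral_Ioi_of_hasDerivAt_of_tendsto hcont hd hi hlim
  have e1 := integral_sub (hi1.add hi2) hi3
  have e2 := integral_add hi1 hi2
  simp only [Pi.add_apply] at e1
  rw [e1, e2, integral_const_mul, integral_const_mul] at this
  unfold PVG
  rw [this]
  simp [Real.zero_rpow hb.ne']

lemma PVG_deriv (b : ℝ) (hb : -1 < b) (μ t : ℝ) (ht : 0 < t) :
    HasDerivAt (fun s => PVG b μ s) (μ * PVG b (μ - 1) t) t := by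
  have hb1 := (PV_int b hb (μ - 1) (t / 2) (by linarith)).const_mul |μ|
  have hb2 := (PV_int b hb (μ - 1) (2 * t) (by linarith)).const_mul |μ|
  have hnhds : Set.Ioo (t / 2) (2 * t) ∈ nhds t := Ioo_mem_nhds (by linarith) (by linarith)
  have := (hasDerivAt_integral_of_dominated_loc_of_deriv_le
    (μ := volume.restrict (Set.Ioi (0 : ℝ)))
    (F := fun s x : ℝ => (x + s) ^ μ * x ^ b * Real.exp (-x))
    (F' := fun s x : ℝ => μ * ((x + s) ^ (μ - 1) * x ^ b * Real.exp (-x)))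
    (x₀ := t) (s := Set.Ioo (t / 2) (2 * t)) (bound := fun x =>
      |μ| * ((x + t / 2) ^ (μ - 1) * x ^ b * Real.exp (-x)) +
      |μ| * ((x + 2 * t) ^ (μ - 1) * x ^ b * Real.exp (-x))) hnhds ?_ ?_ ?_ ?_ ?_ ?_).2
  · rw [integral_const_mul] at this
    exact this
  · filter_upwards [hnhds] with s _
    exact PV_meas b μ s
  · exact PV_int b hb μ t ht
  · exact (PV_meas b (μ - 1) t).const_mul μ
  · refine (ae_restrict_iff' measurableSet_Ioi).2 (Filter.Eventually.of_forall fun x hx s hs => ?_)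
    have hx : 0 < x := hx
    have hb' : 0 < x ^ b := Real.rpow_pos_of_pos hx b
    have he := Real.exp_pos (-x)
    have h1 : 0 < (x + t / 2) ^ (μ - 1) := Real.rpow_pos_of_pos (by linarith) _
    have h2 : 0 < (x + 2 * t) ^ (μ - 1) := Real.rpow_pos_of_pos (by linarith) _
    have h3 : 0 < (x + s) ^ (μ - 1) := Real.rpow_pos_of_pos (by linarith [hs.1]) _
    rw [norm_mul, Real.norm_eq_abs, Real.norm_of_nonneg (by positivity), ← mul_add]
    have key : (x + s) ^ (μ - 1) ≤ (x + t / 2) ^ (μ - 1) + (x + 2 * t) ^ (μ - 1) := by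
      rcases le_total (μ - 1) 0 with h | h
      · have := Real.rpow_le_rpow_of_nonpos (by linarith : 0 < x + t / 2)
          (by linarith [hs.1] : x + t / 2 ≤ x + s) h
        linarith
      · have := Real.rpow_le_rpow (by linarith [hs.1] : 0 ≤ x + s)
          (by linarith [hs.2] : x + s ≤ x + 2 * t) h
        linarith
    have : (x + s) ^ (μ - 1) * (x ^ b * Real.exp (-x)) ≤
      ((x + t / 2) ^ (μ - 1) + (x + 2 * t) ^ (μ - 1)) * (x ^ b * Real.exp (-x)) := by gcongr
    apply mul_le_mul_of_nonneg_left _ (abs_nonneg μ)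
    linarith
  · exact hb1.add hb2
  · refine (ae_restrict_iff' measurableSet_Ioi).2 (Filter.Eventually.of_forall fun x hx s hs => ?_)
    have hx : 0 < x := hx
    have h1 : HasDerivAt (fun s : ℝ => (x + s) ^ μ) (1 * μ * (x + s) ^ (μ - 1)) s :=
      ((hasDerivAt_id s).const_add x).rpow_const (Or.inl (by simp; linarith [hs.1]))
    exact ((h1.mul_const (x ^ b)).mul_const (Real.exp (-x))).congr_deriv (by ring)

/-- The functional `q ↦ ∫ q(x) (x+t)^μ x^b e^{-x} dx` -/
noncomputable def PVL (b μ t : ℝ) : Polynomial ℝ →ₗ[ℝ] ℝ :=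
  Polynomial.lsum fun k => LinearMap.mulRight ℝ (PVG (b + k) μ t)

lemma PVL_monomial (b μ t : ℝ) (k : ℕ) (c : ℝ) :
    PVL b μ t (Polynomial.monomial k c) = c * PVG (b + k) μ t := by
  simp [PVL, Polynomial.lsum_apply]

lemma PVL_eq_sum (b μ t : ℝ) (q : Polynomial ℝ) (N : ℕ) (hN : q.natDegree < N) :
    PVL b μ t q = ∑ k ∈ Finset.range N, q.coeff k * PVG (b + k) μ t := by
  conv_lhs => rw [q.as_sum_range' N hN]
  simp [map_sum, PVL_monomial]

lemma PVL_eq_integral (b : ℝ) (hb : -1 < b) (μ t : ℝ) (ht : 0 < t) (q : Polynomial ℝ) :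
    PVL b μ t q = ∫ x in Set.Ioi (0 : ℝ), q.eval x * ((x + t) ^ μ * x ^ b * Real.exp (-x)) := by
  rw [PVL_eq_sum b μ t q _ (Nat.lt_succ_self _)]
  have hk : ∀ k : ℕ, -1 < b + k := fun k => by
    have : (0 : ℝ) ≤ k := Nat.cast_nonneg k
    linarith
  unfold PVG
  simp_rw [← integral_const_mul]
  rw [← integral_finsetSum _ fun (k : ℕ) _ => (PV_int (b + k) (hk k) μ t ht).const_mul (q.coeff k)]
  refine setIntegral_congr_fun measurableSet_Ioi fun x hx => ?_
  have hx : 0 < x := hx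
  rw [Polynomial.eval_eq_sum_range, Finset.sum_mul]
  refine Finset.sum_congr rfl fun k _ => ?_
  rw [Real.rpow_add hx, Real.rpow_natCast]
  ring

open Polynomial in
lemma PVL_X (b μ t : ℝ) (q : ℝ[X]) : PVL (b - 1) μ t (X * q) = PVL b μ t q := by
  induction q using Polynomial.induction_on' with
  | add p q hp hq => rw [mul_add, map_add, map_add, hp, hq]
  | monomial k c =>
    rw [X_mul_monomial, PVL_monomial, PVL_monomial]
    congr 2
    push_cast
    ring

open Polynomial in
lemma PVL_Xt (b : ℝ) (hb : -1 < b) (μ t : ℝ) (ht : 0 < t) (q : ℝ[X]) :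
    PVL b (μ - 1) t ((X + C t) * q) = PVL b μ t q := by
  induction q using Polynomial.induction_on' with
  | add p q hp hq => rw [mul_add, map_add, map_add, hp, hq]
  | monomial k c =>
    have hk : -1 < b + k := by
      have : (0 : ℝ) ≤ k := Nat.cast_nonneg k
      linarith
    rw [add_mul, map_add, X_mul_monomial, C_mul_monomial, PVL_monomial, PVL_monomial, PVL_monomial,
      ← PVG_shift (b + k) hk μ t ht]
    push_cast
    rw [← add_assoc]
    ring

open Polynomial in
lemma PVL_ibp (b : ℝ) (hb : 0 < b) (μ t : ℝ) (ht : 0 < t) (q : ℝ[X]) :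
    PVL b μ t (derivative q) - PVL b μ t q + b * PVL (b - 1) μ t q +
      μ * PVL b (μ - 1) t q = 0 := by
  induction q using Polynomial.induction_on' with
  | add p q hp hq =>
    simp only [map_add]
    linear_combination hp + hq
  | monomial k c =>
    have hk : 0 < b + k := by positivity
    have h := PVG_ibp (b + k) hk μ t ht
    rw [derivative_monomial, PVL_monomial, PVL_monomial, PVL_monomial, PVL_monomial]
    have e1 : b - 1 + k = b + k - 1 := by ring
    rw [e1]
    rcases Nat.eq_zero_or_pos k with h0 | h0
    · subst h0
      simp only [Nat.cast_zero, add_zero, mul_zero, zero_mul] at h ⊢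
      linear_combination c * h
    · have e2 : b + ((k - 1 : ℕ) : ℝ) = b + k - 1 := by
        rw [Nat.cast_sub h0]; push_cast; ring
      rw [e2]
      linear_combination c * h

section PVAlg
open Polynomial

structure PVOrth (L : ℝ[X] →ₗ[ℝ] ℝ) (p : ℕ → ℝ[X]) (h : ℕ → ℝ) : Prop where
  monic : ∀ k, (p k).Monic
  deg : ∀ k, (p k).natDegree = k
  ne : ∀ k, h k ≠ 0
  orth : ∀ j k, L (p j * p k) = if j = k then h j else 0

variable {L : ℝ[X] →ₗ[ℝ] ℝ} {p : ℕ → ℝ[X]} {h : ℕ → ℝ}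

lemma PVOrth.coeff_top (o : PVOrth L p h) (k : ℕ) : (p k).coeff k = 1 := by
  have := o.monic k
  rw [Monic, leadingCoeff, o.deg k] at this
  exact this

lemma PVOrth.coeff_gt (o : PVOrth L p h) (k j : ℕ) (hj : k < j) : (p k).coeff j = 0 :=
  coeff_eq_zero_of_natDegree_lt (by rw [o.deg k]; exact hj)

lemma PV_C_mul (L : ℝ[X] →ₗ[ℝ] ℝ) (c : ℝ) (q : ℝ[X]) : L (C c * q) = c * L q := by
  rw [← smul_eq_C_mul, map_smul, smul_eq_mul]

lemma PVOrth.expand (o : PVOrth L p h) (n : ℕ) : ∀ q : ℝ[X], (∀ k, n ≤ k → q.coeff k = 0) →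
    ∃ c : ℕ → ℝ, q = ∑ k ∈ Finset.range n, C (c k) * p k := by
  induction n with
  | zero =>
    intro q hq
    refine ⟨0, ?_⟩
    ext k
    simpa using hq k (Nat.zero_le k)
  | succ n ih =>
    intro q hq
    obtain ⟨c, hc⟩ := ih (q - C (q.coeff n) * p n) (by
      intro k hk
      rw [coeff_sub, coeff_C_mul]
      rcases hk.eq_or_lt with rfl | hk
      · rw [o.coeff_top]; ring
      · rw [o.coeff_gt n k hk, hq k hk]; ring)
    refine ⟨fun k => if k = n then q.coeff n else c k, ?_⟩
    rw [Finset.sum_range_succ]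
    have : ∑ k ∈ Finset.range n, C (if k = n then q.coeff n else c k) * p k =
        ∑ k ∈ Finset.range n, C (c k) * p k := by
      refine Finset.sum_congr rfl fun k hk => ?_
      rw [if_neg (Finset.mem_range.1 hk).ne]
    rw [this, ← hc]
    simp

/-- projection -/
lemma PVOrth.proj (o : PVOrth L p h) (n : ℕ) (q : ℝ[X]) (hq : ∀ k, n < k → q.coeff k = 0) :
    L (p n * q) = q.coeff n * h n := by
  obtain ⟨c, hc⟩ := o.expand n (q - C (q.coeff n) * p n) (by
      intro k hk
      rw [coeff_sub, coeff_C_mul]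
      rcases hk.eq_or_lt with rfl | hk
      · rw [o.coeff_top]; ring
      · rw [o.coeff_gt n k hk, hq k hk]; ring)
  have h2 : p n * q = C (q.coeff n) * (p n * p n) + ∑ k ∈ Finset.range n, C (c k) * (p n * p k) := by
    have : q = C (q.coeff n) * p n + ∑ k ∈ Finset.range n, C (c k) * p k := by
      rw [← hc]; ring
    conv_lhs => rw [this]
    rw [mul_add, Finset.mul_sum]
    congr 1
    · ring
    · exact Finset.sum_congr rfl fun k _ => by ring
  rw [h2, map_add, PV_C_mul, o.orth, if_pos rfl, map_sum]
  rw [Finset.sum_eq_zero, add_zero]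
  intro k hk
  rw [PV_C_mul, o.orth, if_neg (Finset.mem_range.1 hk).ne', mul_zero]

lemma PVOrth.eq_zero (o : PVOrth L p h) (n : ℕ) (q : ℝ[X]) (hq : ∀ k, n ≤ k → q.coeff k = 0)
    (hz : ∀ j, j < n → L (p j * q) = 0) : q = 0 := by
  obtain ⟨c, hc⟩ := o.expand n q hq
  rw [hc]
  refine Finset.sum_eq_zero fun j hj => ?_
  have := hz j (Finset.mem_range.1 hj)
  rw [hc, Finset.mul_sum, map_sum, Finset.sum_eq_single j] at this
  · rw [mul_left_comm, PV_C_mul, o.orth, if_pos rfl] at this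
    rcases mul_eq_zero.1 this with h0 | h0
    · rw [h0]; simp
    · exact absurd h0 (o.ne j)
  · intro k _ hk
    rw [mul_left_comm, PV_C_mul, o.orth, if_neg (Ne.symm hk), mul_zero]
  · intro hn
    exact absurd hj hn

lemma PVOrth.kernel (o : PVOrth L p h) (a : ℝ) (K : ℝ[X] →ₗ[ℝ] ℝ)
    (hK : ∀ q, K ((X - C a) * q) = L q) (m : ℕ) :
    K (p (m+1) * p (m+1)) * K (p m * p m) =
      K (p (m+1) * p m) * (K (p (m+1) * p m) - h m) := by
  have hdiv : ∀ n, ∃ g : ℝ[X], p n = C ((p n).eval a) + (X - C a) * g ∧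
      ∀ k, g.coeff k = (p n).coeff (k+1) + a * g.coeff (k+1) := by
    intro n
    obtain ⟨g, hg⟩ := X_sub_C_dvd_sub_C_eval (a := a) (p := p n)
    have h1 : p n = C ((p n).eval a) + (X - C a) * g := by rw [← hg]; ring
    refine ⟨g, h1, fun k => ?_⟩
    have h2 := congrArg (fun q => coeff q (k+1)) h1
    simp only [coeff_add, sub_mul, coeff_sub, coeff_X_mul, coeff_C_mul, coeff_C_succ] at h2
    linarith
  have hz : ∀ n, ∃ g : ℝ[X], p n = C ((p n).eval a) + (X - C a) * g ∧
      (∀ k, n ≤ k → g.coeff k = 0) ∧ (∀ k, k + 1 = n → g.coeff k = 1) := by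
    intro n
    obtain ⟨g, hg, hc⟩ := hdiv n
    have hz1 : ∀ k, n ≤ k → g.coeff k = 0 := by
      intro k hk
      by_cases hlt : g.natDegree < k
      · exact coeff_eq_zero_of_natDegree_lt hlt
      · have : ∀ d, ∀ j, n ≤ j → g.natDegree < j + d → g.coeff j = 0 := by
          intro d
          induction d with
          | zero => intro j _ hj; exact coeff_eq_zero_of_natDegree_lt hj
          | succ d ih =>
            intro j hj hd
            rw [hc j, o.coeff_gt n (j+1) (by omega), ih (j+1) (by omega) (by omega)]
            ring
        exact this (g.natDegree + 1) k hk (by omega)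
    refine ⟨g, hg, hz1, ?_⟩
    intro k hk
    rw [hc k, hk, o.coeff_top, hz1 n le_rfl]
    ring
  have hKd : ∀ n f g, p n = C ((p n).eval a) + (X - C a) * g →
      K (f * p n) = (p n).eval a * K f + L (f * g) := by
    intro n f g hg
    conv_lhs => rw [hg]
    rw [mul_add, map_add, mul_comm f (C _), PV_C_mul, mul_left_comm, hK]
  obtain ⟨g, hg, hg0, hg1⟩ := hz m
  obtain ⟨G, hG, hG0, hG1⟩ := hz (m+1)
  have e1 : K (p (m+1) * p m) = (p m).eval a * K (p (m+1)) := by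
    rw [hKd m _ g hg, o.proj (m+1) g (fun k hk => hg0 k (by omega)), hg0 (m+1) (by omega)]
    ring
  have e2 : K (p (m+1) * p (m+1)) = (p (m+1)).eval a * K (p (m+1)) := by
    rw [hKd (m+1) _ G hG, o.proj (m+1) G (fun k hk => hG0 k (by omega)), hG0 (m+1) (by omega)]
    ring
  have e3 : K (p m * p m) = (p m).eval a * K (p m) := by
    rw [hKd m _ g hg, o.proj m g (fun k hk => hg0 k (by omega)), hg0 m (by omega)]
    ring
  have e4 : K (p (m+1) * p m) = (p (m+1)).eval a * K (p m) + h m := by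
    rw [mul_comm, hKd (m+1) _ G hG, o.proj m G (fun k hk => hG0 k (by omega)), hG1 m rfl]
    ring
  have e5 : K (p (m+1) * p m) - h m = (p (m+1)).eval a * K (p m) := by rw [e4]; ring
  rw [e5, e1, e2, e3]
  ring

lemma PVOrth.recur (o : PVOrth L p h) (m : ℕ) :
    p (m+2) = X * p (m+1) - C ((p (m+1)).coeff m - (p (m+2)).coeff (m+1)) * p (m+1)
      - C (h (m+1) / h m) * p m := by
  have hXP : L (p (m+1) * (X * p (m+1))) =
      ((p (m+1)).coeff m - (p (m+2)).coeff (m+1)) * h (m+1) := by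
    have h1 := o.proj (m+1) (X * p (m+1) - p (m+2)) (by
      intro k hk
      obtain ⟨k, rfl⟩ : ∃ j, k = j + 1 := ⟨k - 1, by omega⟩
      rw [coeff_sub, coeff_X_mul]
      rcases (show m + 1 = k ∨ m + 1 < k by omega) with rfl | hk
      · rw [o.coeff_top, o.coeff_top]; ring
      · rw [o.coeff_gt _ _ hk, o.coeff_gt _ _ (by omega)]; ring)
    rw [mul_sub, map_sub, o.orth (m+1) (m+2), if_neg (by omega), coeff_sub, coeff_X_mul] at h1
    linarith
  rw [← sub_eq_zero]
  refine o.eq_zero (m+3) _ ?_ ?_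
  · intro k hk
    obtain ⟨k, rfl⟩ : ∃ j, k = j + 1 := ⟨k - 1, by omega⟩
    simp only [coeff_sub, coeff_X_mul, coeff_C_mul]
    rw [o.coeff_gt _ _ (by omega : m+2 < k+1), o.coeff_gt _ _ (by omega : m+1 < k),
      o.coeff_gt _ _ (by omega : m+1 < k+1), o.coeff_gt _ _ (by omega : m < k+1)]
    ring
  · intro j hj
    have hrw : p j * (p (m+2) - (X * p (m+1) - C ((p (m+1)).coeff m - (p (m+2)).coeff (m+1)) *
        p (m+1) - C (h (m+1) / h m) * p m)) = p j * p (m+2) - p j * (X * p (m+1)) +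
        C ((p (m+1)).coeff m - (p (m+2)).coeff (m+1)) * (p j * p (m+1)) +
        C (h (m+1) / h m) * (p j * p m) := by ring
    rw [hrw, map_add, map_add, map_sub, PV_C_mul, PV_C_mul, o.orth, o.orth, o.orth]
    rcases (show j = m+2 ∨ j = m+1 ∨ j = m ∨ j < m by omega) with rfl | rfl | rfl | hj
    · rw [o.proj (m+2) (X * p (m+1)) (by
        intro k hk
        obtain ⟨k, rfl⟩ : ∃ j, k = j + 1 := ⟨k - 1, by omega⟩
        rw [coeff_X_mul, o.coeff_gt _ _ (by omega)]), coeff_X_mul, o.coeff_top]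
      simp
    · rw [hXP]
      simp
    · rw [show p j * (X * p (j+1)) = p (j+1) * (X * p j) by ring, o.proj (j+1) (X * p j) (by
        intro k hk
        obtain ⟨k, rfl⟩ : ∃ j, k = j + 1 := ⟨k - 1, by omega⟩
        rw [coeff_X_mul, o.coeff_gt _ _ (by omega)]), coeff_X_mul, o.coeff_top]
      have := o.ne j
      simp
      field_simp
      ring
    · rw [show p j * (X * p (m+1)) = p (m+1) * (X * p j) by ring, o.proj (m+1) (X * p j) (by
        intro k hk
        obtain ⟨k, rfl⟩ : ∃ j, k = j + 1 := ⟨k - 1, by omega⟩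
        rw [coeff_X_mul, o.coeff_gt _ _ (by omega)]), coeff_X_mul, o.coeff_gt _ _ hj,
        if_neg (by omega), if_neg (by omega), if_neg (by omega)]
      simp

/-- The algebraic identities at a fixed `t`. -/
lemma PVOrth.identities (o : PVOrth L p h) (J K : ℝ[X] →ₗ[ℝ] ℝ) (α lam t : ℝ)
    (hJ : ∀ q, J (X * q) = L q) (hK : ∀ q, K ((X + C t) * q) = L q)
    (hibp : ∀ q, L (derivative q) - L q + α * J q + lam * K q = 0)
    (m : ℕ) (R S r rN : ℝ)
    (hR : R * h (m+1) = lam * K (p (m+1) * p (m+1)))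
    (hS : S * h m = lam * K (p m * p m))
    (hr : r * h m = lam * K (p (m+1) * p m))
    (hrN : rN * h (m+1) = lam * K (p (m+2) * p (m+1))) :
    ((p (m+1)).coeff m - (p (m+2)).coeff (m+1) = 2 * ((m:ℝ)+1) + 1 + α + lam - t * R) ∧
    ((p (m+1)).coeff m = - (h (m+1) / h m) - t * r) ∧
    ((h (m+1) / h m) * (R * S) = r ^ 2 - lam * r) ∧
    ((h (m+1) / h m) * ((1 - R) * (1 - S)) = ((m:ℝ) + 1 + r) * ((m:ℝ) + 1 + r + α)) ∧
    (rN = lam - t * R - ((p (m+1)).coeff m - (p (m+2)).coeff (m+1)) * R - r) := by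
  have hm := o.ne m
  have hm1 := o.ne (m+1)
  have hKX : ∀ q, K (X * q) = L q - t * K q := by
    intro q
    have := hK q
    rw [add_mul, map_add, PV_C_mul] at this
    linarith
  have hrec := o.recur m
  set A := (p (m+1)).coeff m - (p (m+2)).coeff (m+1) with hA
  -- elementary values
  have hXP : L (p (m+1) * (X * p (m+1))) = A * h (m+1) := by
    have : p (m+1) * (X * p (m+1)) = p (m+1) * p (m+2) + C A * (p (m+1) * p (m+1)) +
        C (h (m+1) / h m) * (p (m+1) * p m) := by
      conv_rhs => rw [hrec]
      ring
    rw [this, map_add, map_add, PV_C_mul, PV_C_mul, o.orth, o.orth, o.orth]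
    simp
  have hXPQ : L (p (m+1) * (X * p m)) = h (m+1) := by
    rw [o.proj (m+1) (X * p m) (by
        intro k hk
        obtain ⟨k, rfl⟩ : ∃ j, k = j + 1 := ⟨k - 1, by omega⟩
        rw [coeff_X_mul, o.coeff_gt _ _ (by omega)]), coeff_X_mul, o.coeff_top, one_mul]
  have hPd : ∀ n, L (p n * derivative (p n)) = 0 := by
    intro n
    rw [o.proj n _ (by
      intro k hk
      rw [coeff_derivative, o.coeff_gt _ _ (by omega), zero_mul]), coeff_derivative,
      o.coeff_gt _ _ (by omega)]
    ring
  have hXPd : L (p (m+1) * (X * derivative (p (m+1)))) = ((m:ℝ)+1) * h (m+1) := by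
    rw [o.proj (m+1) _ (by
      intro k hk
      obtain ⟨k, rfl⟩ : ∃ j, k = j + 1 := ⟨k - 1, by omega⟩
      rw [coeff_X_mul, coeff_derivative, o.coeff_gt _ _ (by omega), zero_mul]), coeff_X_mul,
      coeff_derivative, o.coeff_top]
    ring
  have hXPQd : L (p (m+1) * (X * derivative (p m))) = 0 := by
    rw [o.proj (m+1) _ (by
      intro k hk
      obtain ⟨k, rfl⟩ : ∃ j, k = j + 1 := ⟨k - 1, by omega⟩
      rw [coeff_X_mul, coeff_derivative, o.coeff_gt _ _ (by omega), zero_mul]), coeff_X_mul,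
      coeff_derivative, o.coeff_gt _ _ (by omega)]
    ring
  have hPQd : L (p (m+1) * derivative (p m)) = 0 := by
    rw [o.proj (m+1) _ (by
      intro k hk
      rw [coeff_derivative, o.coeff_gt _ _ (by omega), zero_mul]),
      coeff_derivative, o.coeff_gt _ _ (by omega)]
    ring
  have hQPd : L (p m * derivative (p (m+1))) = ((m:ℝ)+1) * h m := by
    rw [o.proj m _ (by
      intro k hk
      rw [coeff_derivative, o.coeff_gt _ _ (by omega), zero_mul]), coeff_derivative, o.coeff_top]
    ring
  have hXQPd : L (p m * (X * derivative (p (m+1)))) = - (p (m+1)).coeff m * h m := by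
    have hcX : ∀ (q : ℝ[X]) k, (X * derivative q).coeff k = k * q.coeff k := by
      intro q k
      cases k with
      | zero => simp
      | succ k => rw [coeff_X_mul, coeff_derivative]; push_cast; ring
    have h1 := o.proj m (X * derivative (p (m+1)) - C ((m:ℝ)+1) * p (m+1)) (by
      intro k hk
      rw [coeff_sub, coeff_C_mul, hcX]
      rcases (show k = m+1 ∨ m+1 < k by omega) with rfl | hk
      · push_cast; ring
      · rw [o.coeff_gt _ _ hk]; ring)
    rw [mul_sub, map_sub, mul_left_comm (p m) (C _), PV_C_mul, o.orth, if_neg (by omega), coeff_sub,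
      coeff_C_mul, hcX] at h1
    linear_combination h1
  have oPP : L (p (m+1) * p (m+1)) = h (m+1) := by rw [o.orth, if_pos rfl]
  have oQQ : L (p m * p m) = h m := by rw [o.orth, if_pos rfl]
  have oPQ : L (p (m+1) * p m) = 0 := by rw [o.orth, if_neg (by omega)]
  -- integration by parts
  have i1 := hibp (X * (p (m+1) * p (m+1)))
  rw [hJ, hKX, show derivative (X * (p (m+1) * p (m+1))) = p (m+1) * p (m+1) +
    (p (m+1) * (X * derivative (p (m+1))) + p (m+1) * (X * derivative (p (m+1)))) by
      simp only [derivative_mul, derivative_X]; ring, map_add, map_add,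
    show X * (p (m+1) * p (m+1)) = p (m+1) * (X * p (m+1)) by ring, hXP, hXPd, oPP] at i1
  have i2 := hibp (X * (p (m+1) * p m))
  rw [hJ, hKX, show derivative (X * (p (m+1) * p m)) = p (m+1) * p m +
    (p m * (X * derivative (p (m+1))) + p (m+1) * (X * derivative (p m))) by
      simp only [derivative_mul, derivative_X]; ring, map_add, map_add,
    show X * (p (m+1) * p m) = p (m+1) * (X * p m) by ring, hXPQ, hXQPd, hXPQd, oPQ] at i2
  have i3 := hibp (p (m+1) * p (m+1))
  rw [show derivative (p (m+1) * p (m+1)) = p (m+1) * derivative (p (m+1)) +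
    p (m+1) * derivative (p (m+1)) by simp only [derivative_mul]; ring, map_add, hPd, oPP] at i3
  have i4 := hibp (p m * p m)
  rw [show derivative (p m * p m) = p m * derivative (p m) +
    p m * derivative (p m) by simp only [derivative_mul]; ring, map_add, hPd, oQQ] at i4
  have i5 := hibp (p (m+1) * p m)
  rw [show derivative (p (m+1) * p m) = p m * derivative (p (m+1)) +
    p (m+1) * derivative (p m) by simp only [derivative_mul]; ring, map_add, hQPd, hPQd, oPQ] at i5
  have k1 := o.kernel (-t) K (by intro q; rw [← hK q]; simp) m
  have k2 := o.kernel 0 J (by intro q; rw [← hJ q]; simp) m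
  have kN : K (p (m+2) * p (m+1)) = L (p (m+1) * p (m+1)) - t * K (p (m+1) * p (m+1)) -
      A * K (p (m+1) * p (m+1)) - h (m+1) / h m * K (p (m+1) * p m) := by
    rw [← hKX, ← PV_C_mul, ← PV_C_mul, ← map_sub, ← map_sub]
    conv_lhs => rw [hrec]
    congr 1
    ring
  have jP : α * J (p (m+1) * p (m+1)) = (1 - R) * h (m+1) := by linear_combination i3 + hR
  have jQ : α * J (p m * p m) = (1 - S) * h m := by linear_combination i4 + hS
  have jPQ : α * J (p (m+1) * p m) = - ((m:ℝ) + 1 + r) * h m := by linear_combination i5 + hr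
  refine ⟨?_, ?_, ?_, ?_, ?_⟩
  · apply mul_right_cancel₀ hm1
    linear_combination -i1 + t * hR
  · apply mul_right_cancel₀ hm
    field_simp
    linear_combination -i2 + t * hr
  · have : (R * h (m+1)) * (S * h m) = (r * h m) * (r * h m - lam * h m) := by
      rw [hR, hS, hr]
      linear_combination lam ^ 2 * k1
    field_simp
    apply mul_right_cancel₀ hm
    linear_combination this
  · have : ((1 - R) * h (m+1)) * ((1 - S) * h m) =
        (- ((m:ℝ) + 1 + r) * h m) * (- ((m:ℝ) + 1 + r) * h m - α * h m) := by
      rw [← jP, ← jQ, ← jPQ]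
      linear_combination α ^ 2 * k2
    field_simp
    apply mul_right_cancel₀ hm
    linear_combination this
  · apply mul_right_cancel₀ hm1
    rw [hrN, kN, oPP]
    have : h (m+1) / h m * (lam * K (p (m+1) * p m)) = r * h (m+1) := by
      rw [← hr]; field_simp
    linear_combination -this - (t + A) * hR.symm

end PVAlg

section PVT
open Polynomial

lemma PV_natCast_gt (α : ℝ) (hα : 0 < α) (i : ℕ) : -1 < α + i := by
  have : (0 : ℝ) ≤ i := Nat.cast_nonneg i
  linarith

lemma PVL_cont (α lam : ℝ) (hα : 0 < α) (t : ℝ) (ht : 0 < t) (N : ℕ) (q : ℝ → ℝ[X])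
    (hN : ∀ᶠ s in nhds t, (q s).natDegree < N)
    (hq : ∀ i, ContinuousAt (fun s => (q s).coeff i) t) :
    ContinuousAt (fun s => PVL α lam s (q s)) t := by
  have h1 : (fun s => ∑ k ∈ Finset.range N, (q s).coeff k * PVG (α + k) lam s) =ᶠ[nhds t]
      (fun s => PVL α lam s (q s)) := by
    filter_upwards [hN] with s hs
    rw [PVL_eq_sum _ _ _ _ N hs]
  refine ContinuousAt.congr ?_ h1
  refine tendsto_finsetSum _ fun i _ => ?_
  exact (hq i).mul (PVG_deriv (α + i) (PV_natCast_gt α hα i) lam t ht).continuousAt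

lemma PVL_slope (α lam : ℝ) (hα : 0 < α) (t : ℝ) (ht : 0 < t) (N : ℕ) (q : ℝ → ℝ[X])
    (hN : ∀ᶠ s in nhds t, (q s).natDegree < N)
    (hq : ∀ i, ContinuousAt (fun s => (q s).coeff i) t) :
    Filter.Tendsto (fun s => (s - t)⁻¹ * (PVL α lam s (q s) - PVL α lam t (q s)))
      (nhdsWithin t {t}ᶜ) (nhds (lam * PVL α (lam - 1) t (q t))) := by
  have h1 : (fun s => ∑ k ∈ Finset.range N, (q s).coeff k *
      ((s - t)⁻¹ * (PVG (α + k) lam s - PVG (α + k) lam t))) =ᶠ[nhdsWithin t {t}ᶜ]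
      (fun s => (s - t)⁻¹ * (PVL α lam s (q s) - PVL α lam t (q s))) := by
    filter_upwards [hN.filter_mono nhdsWithin_le_nhds] with s hs
    rw [PVL_eq_sum _ _ _ _ N hs, PVL_eq_sum _ _ _ _ N hs, ← Finset.sum_sub_distrib,
      Finset.mul_sum]
    exact Finset.sum_congr rfl fun k _ => by ring
  refine Filter.Tendsto.congr' h1 ?_
  rw [PVL_eq_sum _ _ _ _ N hN.self_of_nhds, Finset.mul_sum]
  refine tendsto_finsetSum _ fun i _ => ?_
  have h2 := hasDerivAt_iff_tendsto_slope.1 (PVG_deriv (α + i) (PV_natCast_gt α hα i) lam t ht)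
  have h3 := ((hq i).tendsto.mono_left (nhdsWithin_le_nhds (s := {t}ᶜ))).mul h2
  rw [show lam * ((q t).coeff i * PVG (α + i) (lam - 1) t) =
    (q t).coeff i * (lam * PVG (α + i) (lam - 1) t) by ring]
  exact h3

lemma PV_coeff_mul_cont (t : ℝ) (f g : ℝ → ℝ[X])
    (hf : ∀ i, ContinuousAt (fun s => (f s).coeff i) t)
    (hg : ∀ i, ContinuousAt (fun s => (g s).coeff i) t) (i : ℕ) :
    ContinuousAt (fun s => (f s * g s).coeff i) t := by
  simp_rw [coeff_mul]
  exact tendsto_finsetSum _ fun k _ => (hf k.1).mul (hg k.2)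

variable {α lam : ℝ} {I : Set ℝ} {p : ℕ → ℝ → ℝ[X]} {h : ℕ → ℝ → ℝ}

lemma PV_gs {L : ℝ[X] →ₗ[ℝ] ℝ} {p : ℕ → ℝ[X]} {h : ℕ → ℝ} (o : PVOrth L p h) (k : ℕ) :
    p k = X ^ k - ∑ j ∈ Finset.range k, C (L (p j * X ^ k) / h j) * p j := by
  rw [← sub_eq_zero]
  refine o.eq_zero (k + 1) _ ?_ ?_
  · intro i hi
    rw [coeff_sub, coeff_sub, finsetSum_coeff, o.coeff_gt k i (by omega), coeff_X_pow,
      if_neg (by omega), Finset.sum_eq_zero]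
    · ring
    · intro j hj
      rw [coeff_C_mul, o.coeff_gt j i (by have := Finset.mem_range.1 hj; omega), mul_zero]
  · intro i hi
    have hs : L (p i * ∑ j ∈ Finset.range k, C (L (p j * X ^ k) / h j) * p j) =
        ∑ j ∈ Finset.range k, (L (p j * X ^ k) / h j) * (if i = j then h i else 0) := by
      rw [Finset.mul_sum, map_sum]
      refine Finset.sum_congr rfl fun j _ => ?_
      rw [mul_left_comm, PV_C_mul, o.orth]
    rw [mul_sub, mul_sub, map_sub, map_sub, hs, o.orth]
    have hne := o.ne i
    rcases (show i = k ∨ i < k by omega) with rfl | hik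
    · rw [o.proj i (X ^ i) (by intro j hj; rw [coeff_X_pow, if_neg (by omega)]), coeff_X_pow,
        if_pos rfl, if_pos rfl, Finset.sum_eq_zero]
      · ring
      · intro j hj
        rw [if_neg (Finset.mem_range.1 hj).ne', mul_zero]
    · rw [Finset.sum_eq_single i, if_pos rfl, if_neg (by omega)]
      · field_simp
        ring
      · intro j _ hj
        rw [if_neg (Ne.symm hj), mul_zero]
      · intro hh
        exact absurd (Finset.mem_range.2 hik) hh

lemma PV_cont (hα : 0 < α) (hI : IsOpen I) (hpos : I ⊆ Set.Ioi 0)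
    (o : ∀ t ∈ I, PVOrth (PVL α lam t) (fun k => p k t) (fun k => h k t))
    (t : ℝ) (ht : t ∈ I) (k : ℕ) : ∀ i, ContinuousAt (fun s => (p k s).coeff i) t := by
  have hnh : I ∈ nhds t := hI.mem_nhds ht
  induction k using Nat.strong_induction_on with
  | _ k ih =>
    intro i
    have h1 : (fun s => (X ^ k : ℝ[X]).coeff i - ∑ j ∈ Finset.range k,
        (PVL α lam s (p j s * X ^ k) / PVL α lam s (p j s * p j s)) * (p j s).coeff i)
        =ᶠ[nhds t] fun s => (p k s).coeff i := by
      filter_upwards [hnh] with s hs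
      have := congrArg (fun q => coeff q i) (PV_gs (o s hs) k)
      simp only [coeff_sub, finsetSum_coeff, coeff_C_mul] at this
      rw [this]
      congr 1
      refine Finset.sum_congr rfl fun j _ => ?_
      have := (o s hs).orth j j
      simp only [if_true] at this
      rw [this]
    refine ContinuousAt.congr ?_ h1
    refine continuousAt_const.sub ?_
    refine tendsto_finsetSum _ fun j hj => ?_
    have hj := Finset.mem_range.1 hj
    refine ContinuousAt.mul (ContinuousAt.div ?_ ?_ ?_) (ih j hj i)
    · refine PVL_cont α lam hα t (hpos ht) (j + k + 1) (fun s => p j s * X ^ k) ?_ ?_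
      · filter_upwards [hnh] with s hs
        have h2 := natDegree_mul_le (p := p j s) (q := (X : ℝ[X]) ^ k)
        have h3 := (o s hs).deg j
        simp only [natDegree_X_pow] at h2 h3
        omega
      · exact PV_coeff_mul_cont t (fun s => p j s) (fun _ => X ^ k) (ih j hj)
          (fun _ => continuousAt_const)
    · refine PVL_cont α lam hα t (hpos ht) (j + j + 1) (fun s => p j s * p j s) ?_ ?_
      · filter_upwards [hnh] with s hs
        have h2 := natDegree_mul_le (p := p j s) (q := p j s)
        have h3 := (o s hs).deg j
        omega
      · exact PV_coeff_mul_cont t (fun s => p j s) (fun s => p j s) (ih j hj) (ih j hj)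
    · have := (o t ht).orth j j
      simp only [if_true] at this
      rw [this]
      exact (o t ht).ne j

lemma PV_slope (hα : 0 < α) (hI : IsOpen I) (hpos : I ⊆ Set.Ioi 0)
    (o : ∀ t ∈ I, PVOrth (PVL α lam t) (fun k => p k t) (fun k => h k t))
    (t : ℝ) (ht : t ∈ I) (k j : ℕ) :
    Filter.Tendsto (fun s => (s - t)⁻¹ *
      (PVL α lam s (p k s * p j t) - PVL α lam t (p k s * p j t)))
      (nhdsWithin t {t}ᶜ) (nhds (lam * PVL α (lam - 1) t (p k t * p j t))) := by
  refine PVL_slope α lam hα t (hpos ht) (k + j + 1) (fun s => p k s * p j t) ?_ ?_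
  · filter_upwards [hI.mem_nhds ht] with s hs
    have h2 := natDegree_mul_le (p := p k s) (q := p j t)
    have h3 := (o s hs).deg k
    have h4 := (o t ht).deg j
    omega
  · exact PV_coeff_mul_cont t (fun s => p k s) (fun _ => p j t) (PV_cont hα hI hpos o t ht k)
      (fun _ => continuousAt_const)

lemma PV_h_deriv (hα : 0 < α) (hI : IsOpen I) (hpos : I ⊆ Set.Ioi 0)
    (o : ∀ t ∈ I, PVOrth (PVL α lam t) (fun k => p k t) (fun k => h k t))
    (t : ℝ) (ht : t ∈ I) (k : ℕ) :
    HasDerivAt (h k) (lam * PVL α (lam - 1) t (p k t * p k t)) t := by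
  rw [hasDerivAt_iff_tendsto_slope]
  refine (PV_slope hα hI hpos o t ht k k).congr' ?_
  filter_upwards [mem_nhdsWithin_of_mem_nhds (hI.mem_nhds ht)] with s hs
  have h1 := (o s hs).proj k (p k t) (fun i hi => (o t ht).coeff_gt k i hi)
  have h2 := (o t ht).proj k (p k s) (fun i hi => (o s hs).coeff_gt k i hi)
  have h3 := (o s hs).coeff_top k
  have h4 := (o t ht).coeff_top k
  rw [h1, mul_comm (p k s) (p k t), h2, h3, h4, slope_def_module, smul_eq_mul]
  ring

lemma PV_c_deriv (hα : 0 < α) (hI : IsOpen I) (hpos : I ⊆ Set.Ioi 0)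
    (o : ∀ t ∈ I, PVOrth (PVL α lam t) (fun k => p k t) (fun k => h k t))
    (t : ℝ) (ht : t ∈ I) (m : ℕ) :
    HasDerivAt (fun s => (p (m+1) s).coeff m)
      (- (lam * PVL α (lam - 1) t (p (m+1) t * p m t) / h m t)) t := by
  rw [hasDerivAt_iff_tendsto_slope]
  refine (((PV_slope hα hI hpos o t ht (m+1) m).div_const (h m t)).neg).congr' ?_
  filter_upwards [mem_nhdsWithin_of_mem_nhds (hI.mem_nhds ht)] with s hs
  have h1 := (o s hs).proj (m+1) (p m t) (fun i hi => (o t ht).coeff_gt m i (by omega))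
  have h2 := (o t ht).proj m (p (m+1) s - p (m+1) t) (by
    intro i hi
    rw [coeff_sub]
    rcases (show i = m+1 ∨ m+1 < i by omega) with rfl | hi
    · have h3 := (o s hs).coeff_top (m+1)
      have h4 := (o t ht).coeff_top (m+1)
      rw [h3, h4, sub_self]
    · have h3 := (o s hs).coeff_gt (m+1) i hi
      have h4 := (o t ht).coeff_gt (m+1) i hi
      rw [h3, h4, sub_self])
  have h3 := (o t ht).coeff_gt m (m+1) (by omega)
  have h4 := (o t ht).orth m (m+1)
  have hne := (o t ht).ne m
  rw [if_neg (by omega)] at h4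
  rw [mul_sub, map_sub, h4, sub_zero, coeff_sub] at h2
  rw [h1, mul_comm (p (m+1) s) (p m t), h2, h3, slope_def_module, smul_eq_mul]
  field_simp
  ring

end PVT

/-- Elimination of the auxiliary quantities. -/
lemma PV_final (t R r n a l be S Rp rp Rpp : ℝ) (ht : t ≠ 0) (hR0 : R ≠ 0) (hR1 : R - 1 ≠ 0)
    (e6 : be * (R * S) = r ^ 2 - l * r)
    (e7 : be * ((1 - R) * (1 - S)) = (n + r) * (n + r + a))
    (hRp : Rp = (2 * r - l + R * (t + 2 * n + a + l - t * R)) / t)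
    (hrp : rp = (be * S - be * R) / t)
    (hRpp : Rpp = (2 * rp + Rp * (t + 2 * n + a + l - t * R) + R * (1 - R - t * Rp) - Rp) / t) :
    -Rpp / (R - 1) ^ 2 + 2 * Rp ^ 2 / (R - 1) ^ 3 =
      (3 * (R / (R - 1)) - 1) / (2 * (R / (R - 1)) * (R / (R - 1) - 1)) *
        (-Rp / (R - 1) ^ 2) ^ 2 - (-Rp / (R - 1) ^ 2) / t
      + (R / (R - 1) - 1) ^ 2 / (2 * t ^ 2) * (a ^ 2 * (R / (R - 1)) - l ^ 2 / (R / (R - 1)))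
      + (2 * n + 1 + a + l) * (R / (R - 1)) / t
      - (R / (R - 1)) * (R / (R - 1) + 1) / (2 * (R / (R - 1) - 1)) := by
  have hX : be * S = (r ^ 2 - l * r) / R := by
    rw [eq_div_iff hR0]; linear_combination e6
  have hbe : be = - ((r ^ 2 - l * r) / R + n * (n + a) + (2 * n + a + l) * r) / (R - 1) := by
    rw [eq_div_iff hR1, ← hX]; linear_combination -e7 + e6
  have hy : R / (R - 1) - 1 = 1 / (R - 1) := by field_simp; ring
  have hrp2 : rp = ((r ^ 2 - l * r) / R +
      ((r ^ 2 - l * r) / R + n * (n + a) + (2 * n + a + l) * r) / (R - 1) * R) / t := by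
    rw [hrp, hX, hbe]; ring
  rw [hy, hRpp, hrp2, hRp]
  field_simp
  ring

open MeasureTheory Set Finset

/-- Chen–McKay: `y_n(t) = R_n(t)/(R_n(t) − 1)`, built from the auxiliary
quantity `R_n(t) = (λ/h_n(t)) ∫₀^∞ π_n(x;t)² w(x,t)/(x+t) dx` for the perturbed Laguerre
weight, satisfies a particular Painlevé V equation. -/
theorem y_n_satisfies_painleveV
    (n : ℕ) (hn : 1 ≤ n) (α lam : ℝ) (hα : 0 < α) (hsum : α + lam + 1 > 0)
    (I : Set ℝ) (hIopen : IsOpen I) (hIsub : I ⊆ Set.Ioi (0 : ℝ))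
    (p : ℕ → ℝ → Polynomial ℝ) (h : ℕ → ℝ → ℝ)
    (hmonic : ∀ k, ∀ t ∈ I, (p k t).Monic)
    (hdeg : ∀ k, ∀ t ∈ I, (p k t).natDegree = k)
    (hpos : ∀ k, ∀ t ∈ I, 0 < h k t)
    (horth : ∀ j k, ∀ t ∈ I,
      ∫ x in Set.Ioi (0 : ℝ),
          (p j t).eval x * (p k t).eval x * ((x + t) ^ lam * x ^ α * Real.exp (-x))
        = if j = k then h j t else 0)
    (R : ℝ → ℝ)
    (hR : ∀ t ∈ I, R t = (lam / h n t) * ∫ x in Set.Ioi (0 : ℝ),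
        (p n t).eval x ^ 2 * ((x + t) ^ lam * x ^ α * Real.exp (-x)) / (x + t))
    (hRsmooth : ContDiffOn ℝ 2 R I)
    (hRne : ∀ t ∈ I, R t ≠ 1)
    (y : ℝ → ℝ)
    (hy : ∀ t, y t = R t / (R t - 1))
    (hy0 : ∀ t ∈ I, y t ≠ 0)
    (hy1 : ∀ t ∈ I, y t ≠ 1) :
    ∀ t ∈ I,
      deriv (deriv y) t
        = (3 * y t - 1) / (2 * y t * (y t - 1)) * (deriv y t) ^ 2
          - deriv y t / t
          + (y t - 1) ^ 2 / (2 * t ^ 2) * (α ^ 2 * y t - lam ^ 2 / y t)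
          + (2 * n + 1 + α + lam) * y t / t
          - y t * (y t + 1) / (2 * (y t - 1)) := by
  obtain ⟨m, rfl⟩ : ∃ m, n = m + 1 := ⟨n - 1, by omega⟩
  have hα1 : -1 < α := by linarith
  have o : ∀ t ∈ I, PVOrth (PVL α lam t) (fun k => p k t) (fun k => h k t) := by
    intro t ht
    refine ⟨fun k => hmonic k t ht, fun k => hdeg k t ht, fun k => (hpos k t ht).ne', ?_⟩
    intro j k
    rw [PVL_eq_integral α hα1 lam t (hIsub ht), ← horth j k t ht]
    simp only [Polynomial.eval_mul]
  set S : ℝ → ℝ := fun s => lam * PVL α (lam - 1) s (p m s * p m s) / h m s with hSdef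
  set r : ℝ → ℝ := fun s => lam * PVL α (lam - 1) s (p (m+1) s * p m s) / h m s with hrdef
  set rN : ℝ → ℝ := fun s =>
    lam * PVL α (lam - 1) s (p (m+2) s * p (m+1) s) / h (m+1) s with hrNdef
  have hRK : ∀ s ∈ I, R s * h (m+1) s = lam * PVL α (lam - 1) s (p (m+1) s * p (m+1) s) := by
    intro s hs
    have hs0 : 0 < s := hIsub hs
    have hh := (hpos (m+1) s hs).ne'
    rw [hR s hs, PVL_eq_integral α hα1 (lam - 1) s hs0]
    have : ∫ x in Set.Ioi (0 : ℝ), (p (m+1) s).eval x ^ 2 *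
          ((x + s) ^ lam * x ^ α * Real.exp (-x)) / (x + s) =
        ∫ x in Set.Ioi (0 : ℝ), (p (m+1) s * p (m+1) s).eval x *
          ((x + s) ^ (lam - 1) * x ^ α * Real.exp (-x)) := by
      refine setIntegral_congr_fun measurableSet_Ioi fun x hx => ?_
      have hx : 0 < x := hx
      have hxs : x + s ≠ 0 := by linarith
      rw [Polynomial.eval_mul, Real.rpow_sub_one hxs]
      ring
    rw [this]
    field_simp
  have hid : ∀ s ∈ I, _ := fun s hs => (o s hs).identities (PVL (α - 1) lam s)
    (PVL α (lam - 1) s) α lam s (PVL_X α lam s) (PVL_Xt α hα1 lam s (hIsub hs))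
    (PVL_ibp α hα lam s (hIsub hs)) m (R s) (S s) (r s) (rN s) (hRK s hs)
    (div_mul_cancel₀ _ (hpos m s hs).ne') (div_mul_cancel₀ _ (hpos m s hs).ne')
    (div_mul_cancel₀ _ (hpos (m+1) s hs).ne')
  have hc1 : ∀ s ∈ I, HasDerivAt (fun s => (p (m+1) s).coeff m) (-(r s)) s :=
    fun s hs => PV_c_deriv hα hIopen hIsub o s hs m
  have hc2 : ∀ s ∈ I, HasDerivAt (fun s => (p (m+2) s).coeff (m+1)) (-(rN s)) s :=
    fun s hs => PV_c_deriv hα hIopen hIsub o s hs (m+1)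
  have hh0 : ∀ s ∈ I, HasDerivAt (h m) (S s * h m s) s := by
    intro s hs
    rw [show S s * h m s = _ from div_mul_cancel₀ _ (hpos m s hs).ne']
    exact PV_h_deriv hα hIopen hIsub o s hs m
  have hh1 : ∀ s ∈ I, HasDerivAt (h (m+1)) (R s * h (m+1) s) s := by
    intro s hs
    rw [hRK s hs]
    exact PV_h_deriv hα hIopen hIsub o s hs (m+1)
  have hRd : ∀ s ∈ I, HasDerivAt R
      ((2 * r s - lam + R s * (s + 2 * ((m:ℝ)+1) + α + lam - s * R s)) / s) s := by
    intro s hs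
    have hs0 : s ≠ 0 := (hIsub hs : 0 < s).ne'
    have h1 := (((hc1 s hs).sub (hc2 s hs)).const_sub (2 * ((m:ℝ)+1) + 1 + α + lam)).div
      (hasDerivAt_id s) hs0
    obtain ⟨a1, a2, a3, a4, a5⟩ := hid s hs
    have h2 := h1.congr_of_eventuallyEq (f₁ := R) (by
      filter_upwards [hIopen.mem_nhds hs] with u hu
      have hu0 : u ≠ 0 := (hIsub hu : 0 < u).ne'
      have := (hid u hu).1
      simp only [Pi.sub_apply, Pi.div_apply, id] at this ⊢
      rw [this]
      field_simp
      ring)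
    refine h2.congr_deriv ?_
    simp only [Pi.sub_apply, id] at a1 a5 ⊢
    rw [a5, a1]
    field_simp
    ring
  have hrd : ∀ s ∈ I, HasDerivAt r
      ((h (m+1) s / h m s * S s - h (m+1) s / h m s * R s) / s) s := by
    intro s hs
    have hs0 : s ≠ 0 := (hIsub hs : 0 < s).ne'
    have hm0 := (hpos m s hs).ne'
    have h1 := ((((hh1 s hs).div (hh0 s hs) hm0).add (hc1 s hs)).neg).div
      (hasDerivAt_id s) hs0
    have h2 := h1.congr_of_eventuallyEq (f₁ := r) (by
      filter_upwards [hIopen.mem_nhds hs] with u hu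
      have hu0 : u ≠ 0 := (hIsub hu : 0 < u).ne'
      have := (hid u hu).2.1
      simp only [Pi.add_apply, Pi.neg_apply, Pi.div_apply, id] at this ⊢
      rw [this]
      field_simp
      ring)
    refine h2.congr_deriv ?_
    have a2 := (hid s hs).2.1
    simp only [Pi.add_apply, Pi.neg_apply, Pi.div_apply, id] at a2 ⊢
    rw [a2]
    field_simp
    ring
  set F : ℝ → ℝ := fun s =>
    (2 * r s - lam + R s * (s + 2 * ((m:ℝ)+1) + α + lam - s * R s)) / s with hF
  have hyfun : y = fun s => R s / (R s - 1) := funext hy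
  have hyd : ∀ s ∈ I, HasDerivAt y (-(F s) / (R s - 1) ^ 2) s := by
    intro s hs
    have hne : R s - 1 ≠ 0 := sub_ne_zero.2 (hRne s hs)
    rw [hyfun]
    refine ((hRd s hs).div ((hRd s hs).sub_const 1) hne).congr_deriv ?_
    congr 1
    ring
  intro t ht
  have ht0 : t ≠ 0 := (hIsub ht : 0 < t).ne'
  have hne : R t - 1 ≠ 0 := sub_ne_zero.2 (hRne t ht)
  have hR0 : R t ≠ 0 := by
    intro h0
    apply hy0 t ht
    rw [hy t, h0, zero_div]
  set rp : ℝ := (h (m+1) t / h m t * S t - h (m+1) t / h m t * R t) / t with hrp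
  set Rpp : ℝ := (2 * rp + F t * (t + 2 * ((m:ℝ)+1) + α + lam - t * R t) +
    R t * (1 - R t - t * F t) - F t) / t with hRpp
  have hFd : HasDerivAt F Rpp t := by
    have hRt : HasDerivAt R (F t) t := hRd t ht
    have hrt : HasDerivAt r rp t := hrd t ht
    have e1 : HasDerivAt (fun s => s + 2 * ((m:ℝ)+1) + α + lam - s * R s)
        (1 - (1 * R t + t * F t)) t :=
      ((((hasDerivAt_id t).add_const _).add_const _).add_const _).sub
        ((hasDerivAt_id t).mul hRt)
    have e2 := (((hrt.const_mul 2).sub_const lam).add (hRt.mul e1)).div (hasDerivAt_id t) ht0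
    refine e2.congr_deriv ?_
    simp only [Pi.add_apply, Pi.mul_apply, id]
    have hFt : F t * t = 2 * r t - lam + R t * (t + 2 * ((m:ℝ)+1) + α + lam - t * R t) :=
      div_mul_cancel₀ _ ht0
    rw [hRpp, ← hFt]
    field_simp
    ring
  have hdd : deriv (deriv y) t = -Rpp / (R t - 1) ^ 2 + 2 * (F t) ^ 2 / (R t - 1) ^ 3 := by
    have hev : deriv y =ᶠ[nhds t] fun s => -(F s) / (R s - 1) ^ 2 := by
      filter_upwards [hIopen.mem_nhds ht] with s hs
      exact (hyd s hs).deriv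
    rw [hev.deriv_eq]
    have hRt : HasDerivAt R (F t) t := hRd t ht
    have e3 := hFd.neg.div ((hRt.sub_const 1).pow 2) (pow_ne_zero 2 hne)
    refine (e3.congr_deriv ?_).deriv
    simp only [Pi.neg_apply, Pi.pow_apply]
    field_simp
    ring
  obtain ⟨a1, a2, a3, a4, a5⟩ := hid t ht
  rw [hdd, (hyd t ht).deriv, hy t]
  have := PV_final t (R t) (r t) ((m:ℝ)+1) α lam (h (m+1) t / h m t) (S t) (F t) rp Rpp ht0 hR0 hne
    a3 a4 rfl hrp hRpp
  rw [this]
  push_cast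
  ring
end

section
/- (Chen–McKay, Jimbo–Miwa–Okamoto σ-form.) Let n ≥ 1, α > 0, λ ∈ ℝ with α + λ + 1 > 0, and set δ_n = n + α + λ. Suppose on an open interval I ⊂ (0,∞) the function H_n(t) = t (d/dt) log D_n(t;α,λ) is twice continuously differentiable. Then H_n satisfies on I the σ-form Painlevé V equation ( t H_n″ )² = [ t H_n′ + (n + δ_n) H_n′ − H_n + n λ ]² − 4 H_n′ ( H_n′ + λ ) ( t H_n′ − H_n + n δ_n ). -/
open MeasureTheory Set Finset
open Filter Topology

theorem pv_rpow_le_exp (κ τ : ℝ) (hτ : 0 < τ) :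
    ∃ K : ℝ, ∀ x : ℝ, 0 < x → (x + τ) ^ κ ≤ K * Real.exp (x / 2) := by
  rcases le_or_gt κ 0 with h | h
  · refine ⟨τ ^ κ, fun x hx => ?_⟩
    have h1 : (x + τ) ^ κ ≤ τ ^ κ := Real.rpow_le_rpow_of_nonpos hτ (by linarith) h
    have h2 : 1 ≤ Real.exp (x / 2) := Real.one_le_exp (by linarith)
    have h3 : 0 < τ ^ κ := Real.rpow_pos_of_pos hτ _
    nlinarith
  · refine ⟨Real.exp (τ / 2 + κ * Real.log (2 * κ)), fun x hx => ?_⟩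
    have hy : 0 < x + τ := by linarith
    rw [Real.rpow_def_of_pos hy, ← Real.exp_add]
    apply Real.exp_le_exp.2
    have h1 := Real.log_le_sub_one_of_pos (x := (x + τ) / (2 * κ)) (by positivity)
    rw [Real.log_div hy.ne' (by positivity)] at h1
    have h2 : κ * ((x + τ) / (2 * κ)) = (x + τ) / 2 := by field_simp
    nlinarith

theorem pv_integrable_aux (κ β τ : ℝ) (hτ : 0 < τ) (hβ : -1 < β) :
    IntegrableOn (fun x : ℝ => (x + τ) ^ κ * x ^ β * Real.exp (-x)) (Ioi 0) := by
  obtain ⟨K, hK⟩ := pv_rpow_le_exp κ τ hτ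
  have h1 := integrableOn_rpow_mul_exp_neg_mul_rpow (p := 1) (s := β) (b := 1 / 2) hβ
    one_pos (by norm_num)
  refine Integrable.mono' (h1.const_mul K) ?_ ?_
  · apply Measurable.aestronglyMeasurable
    fun_prop
  · refine (ae_restrict_iff' measurableSet_Ioi).2 (Eventually.of_forall fun x hx => ?_)
    have hx : 0 < x := hx
    have h0 : 0 < (x + τ) ^ κ := Real.rpow_pos_of_pos (by linarith) _
    have h2 : 0 < x ^ β := Real.rpow_pos_of_pos hx _
    rw [Real.norm_of_nonneg (by positivity), Real.rpow_one]
    have h3 : Real.exp (-(1 / 2) * x) = Real.exp (x / 2) * Real.exp (-x) := by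
      rw [← Real.exp_add]; congr 1; ring
    rw [h3]
    have := hK x hx
    calc (x + τ) ^ κ * x ^ β * Real.exp (-x)
        ≤ (K * Real.exp (x / 2)) * x ^ β * Real.exp (-x) := by gcongr
      _ = _ := by ring

theorem pv_integrable (κ β τ : ℝ) (hτ : 0 < τ) (hβ : -1 < β) (p : Polynomial ℝ) :
    IntegrableOn (fun x : ℝ => p.eval x * ((x + τ) ^ κ * x ^ β * Real.exp (-x))) (Ioi 0) := by
  induction p using Polynomial.induction_on' with
  | add p q hp hq =>
    simp only [Polynomial.eval_add, add_mul]
    exact hp.add hq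
  | monomial k a =>
    have h := (pv_integrable_aux κ (β + k) τ hτ
      (by have : (0 : ℝ) ≤ k := k.cast_nonneg
          linarith)).const_mul a
    refine (integrableOn_congr_fun (fun x hx => ?_) measurableSet_Ioi).1 h
    have hx : 0 < x := hx
    simp only [Polynomial.eval_monomial]
    rw [Real.rpow_add hx, Real.rpow_natCast]
    ring

/-- The functional `p ↦ ∫ p(x) (x+τ)^κ x^β e^{-x} dx`. -/
noncomputable def pvF (κ β τ : ℝ) (p : Polynomial ℝ) : ℝ :=
  ∫ x in Ioi (0 : ℝ), p.eval x * ((x + τ) ^ κ * x ^ β * Real.exp (-x))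

theorem pvF_add (κ β τ : ℝ) (hτ : 0 < τ) (hβ : -1 < β) (p q : Polynomial ℝ) :
    pvF κ β τ (p + q) = pvF κ β τ p + pvF κ β τ q := by
  unfold pvF
  rw [← integral_add (pv_integrable κ β τ hτ hβ p) (pv_integrable κ β τ hτ hβ q)]
  simp only [Polynomial.eval_add, add_mul]

theorem pvF_smul (κ β τ : ℝ) (a : ℝ) (p : Polynomial ℝ) :
    pvF κ β τ (a • p) = a * pvF κ β τ p := by
  unfold pvF
  rw [← integral_const_mul]
  simp only [Polynomial.eval_smul, smul_eq_mul, mul_assoc]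

/-- `pvF` as a linear map. -/
noncomputable def pvL (κ β τ : ℝ) (hτ : 0 < τ) (hβ : -1 < β) : Polynomial ℝ →ₗ[ℝ] ℝ where
  toFun := pvF κ β τ
  map_add' := pvF_add κ β τ hτ hβ
  map_smul' := pvF_smul κ β τ

theorem pvF_X (κ β τ : ℝ) (p : Polynomial ℝ) :
    pvF κ (β - 1) τ (Polynomial.X * p) = pvF κ β τ p := by
  unfold pvF
  refine setIntegral_congr_fun measurableSet_Ioi fun x hx => ?_
  have hx : 0 < x := hx
  simp only [Polynomial.eval_mul, Polynomial.eval_X]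
  rw [Real.rpow_sub_one hx.ne']
  field_simp

theorem pvF_Xt (κ β τ : ℝ) (hτ : 0 < τ) (p : Polynomial ℝ) :
    pvF (κ - 1) β τ ((Polynomial.X + Polynomial.C τ) * p) = pvF κ β τ p := by
  unfold pvF
  refine setIntegral_congr_fun measurableSet_Ioi fun x hx => ?_
  have hx : 0 < x := hx
  have h : x + τ ≠ 0 := by linarith
  simp only [Polynomial.eval_mul, Polynomial.eval_X, Polynomial.eval_add, Polynomial.eval_C]
  rw [Real.rpow_sub_one h]
  field_simp

theorem pvF_ibp (κ β τ : ℝ) (hτ : 0 < τ) (hβ : 0 < β) (p : Polynomial ℝ) :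
    pvF κ β τ (Polynomial.derivative p) + κ * pvF (κ - 1) β τ p + β * pvF κ (β - 1) τ p
      - pvF κ β τ p = 0 := by
  have i1 := pv_integrable κ β τ hτ (by linarith) (Polynomial.derivative p)
  have i2 := pv_integrable (κ - 1) β τ hτ (by linarith) p
  have i3 := pv_integrable κ (β - 1) τ hτ (by linarith) p
  have i4 := pv_integrable κ β τ hτ (by linarith) p
  have i23 := (i1.add (i2.const_mul κ)).add (i3.const_mul β)
  have i := i23.sub i4
  have hd : ∀ x ∈ Ioi (0 : ℝ), HasDerivAt
      (fun x : ℝ => p.eval x * ((x + τ) ^ κ * x ^ β * Real.exp (-x)))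
      ((Polynomial.derivative p).eval x * ((x + τ) ^ κ * x ^ β * Real.exp (-x))
        + κ * (p.eval x * ((x + τ) ^ (κ - 1) * x ^ β * Real.exp (-x)))
        + β * (p.eval x * ((x + τ) ^ κ * x ^ (β - 1) * Real.exp (-x)))
        - p.eval x * ((x + τ) ^ κ * x ^ β * Real.exp (-x))) x := by
    intro x hx
    have hx : 0 < x := hx
    have h1 := p.hasDerivAt x
    have h2 := ((hasDerivAt_id x).add_const τ).rpow_const (p := κ)
      (Or.inl (by simp only [id]; linarith))
    have h3 := (hasDerivAt_id x).rpow_const (p := β) (Or.inl (by simpa using hx.ne'))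
    have h4 := (hasDerivAt_neg x).exp
    refine (h1.mul ((h2.mul h3).mul h4)).congr_deriv ?_
    simp
    ring
  have hlim := tendsto_zero_of_hasDerivAt_of_integrableOn_Ioi hd i i4
  have hc : ContinuousWithinAt
      (fun x : ℝ => p.eval x * ((x + τ) ^ κ * x ^ β * Real.exp (-x))) (Ici 0) 0 := by
    apply ContinuousAt.continuousWithinAt
    have c1 : ContinuousAt (fun x : ℝ => (x + τ) ^ κ) 0 :=
      ContinuousAt.rpow_const (by fun_prop) (Or.inl (by simpa using hτ.ne'))
    have c2 : ContinuousAt (fun x : ℝ => x ^ β) 0 :=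
      ContinuousAt.rpow_const (by fun_prop) (Or.inr hβ.le)
    exact (p.continuous.continuousAt).mul ((c1.mul c2).mul (by fun_prop))
  have := integral_Ioi_of_hasDerivAt_of_tendsto hc hd i hlim
  rw [Real.zero_rpow hβ.ne'] at this
  simp only [mul_zero, zero_mul, sub_zero] at this
  unfold pvF
  rw [← integral_const_mul, ← integral_const_mul]
  have t1 := integral_sub' i23 i4
  have t2 := integral_add' (i1.add (i2.const_mul κ)) (i3.const_mul β)
  have t3 := integral_add' i1 (i2.const_mul κ)
  rw [t2, t3] at t1
  exact t1.symm.trans this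

theorem pvF_hasDerivAt (κ β τ : ℝ) (hτ : 0 < τ) (hβ : -1 < β) (p : Polynomial ℝ) :
    HasDerivAt (fun t => pvF κ β t p) (κ * pvF (κ - 1) β τ p) τ := by
  have j1 := (pv_integrable (κ - 1) β (τ / 2) (by linarith) hβ p)
  have j2 := (pv_integrable (κ - 1) β (2 * τ) (by linarith) hβ p)
  have hm : ∀ κ t : ℝ, AEStronglyMeasurable
      (fun x : ℝ => p.eval x * ((x + t) ^ κ * x ^ β * Real.exp (-x)))
      (volume.restrict (Ioi 0)) := by
    intro κ t
    apply Measurable.aestronglyMeasurable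
    have := p.continuous.measurable
    fun_prop
  have key := hasDerivAt_integral_of_dominated_loc_of_deriv_le (μ := volume.restrict (Ioi 0))
    (F := fun t x => p.eval x * ((x + t) ^ κ * x ^ β * Real.exp (-x)))
    (F' := fun t x => κ * (p.eval x * ((x + t) ^ (κ - 1) * x ^ β * Real.exp (-x))))
    (x₀ := τ) (s := Ioo (τ / 2) (2 * τ))
    (bound := fun x => |κ| *
      (‖p.eval x * ((x + τ / 2) ^ (κ - 1) * x ^ β * Real.exp (-x))‖
      + ‖p.eval x * ((x + 2 * τ) ^ (κ - 1) * x ^ β * Real.exp (-x))‖))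
    (Ioo_mem_nhds (by linarith) (by linarith)) (Eventually.of_forall fun t => hm κ t)
    (pv_integrable κ β τ hτ hβ p) ((hm (κ - 1) τ).const_mul κ) ?_
    ((j1.norm.add j2.norm).const_mul _) ?_
  · have := key.2
    rw [integral_const_mul] at this
    exact this
  · refine (ae_restrict_iff' measurableSet_Ioi).2 (Eventually.of_forall fun x hx t ht => ?_)
    have hx : 0 < x := hx
    have h0 : 0 < x ^ β := Real.rpow_pos_of_pos hx _
    have p1 : 0 < (x + τ / 2) ^ (κ - 1) := Real.rpow_pos_of_pos (by linarith) _
    have p2 : 0 < (x + 2 * τ) ^ (κ - 1) := Real.rpow_pos_of_pos (by linarith) _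
    have p3 : 0 < (x + t) ^ (κ - 1) := Real.rpow_pos_of_pos (by linarith [ht.1]) _
    have hle : (x + t) ^ (κ - 1) ≤ (x + τ / 2) ^ (κ - 1) + (x + 2 * τ) ^ (κ - 1) := by
      rcases le_or_gt (κ - 1) 0 with h | h
      · have := Real.rpow_le_rpow_of_nonpos (x := x + τ / 2) (y := x + t)
          (by linarith) (by linarith [ht.1]) h
        linarith
      · have := Real.rpow_le_rpow (x := x + t) (y := x + 2 * τ) (by linarith [ht.1])
          (by linarith [ht.2]) h.le
        linarith
    simp only [norm_mul, Real.norm_eq_abs, abs_of_pos p1, abs_of_pos p2, abs_of_pos p3,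
      abs_of_pos h0, Real.abs_exp]
    calc |κ| * (|p.eval x| * ((x + t) ^ (κ - 1) * x ^ β * Real.exp (-x)))
        ≤ |κ| * (|p.eval x| * (((x + τ / 2) ^ (κ - 1) + (x + 2 * τ) ^ (κ - 1)) * x ^ β
          * Real.exp (-x))) := by gcongr
      _ = _ := by ring
  · refine (ae_restrict_iff' measurableSet_Ioi).2 (Eventually.of_forall fun x hx t ht => ?_)
    have hx : 0 < x := hx
    have h2 := ((hasDerivAt_id t).const_add x).rpow_const (p := κ)
      (Or.inl (by simp only [id]; linarith [ht.1]))
    refine (((h2.mul_const (x ^ β)).mul_const (Real.exp (-x))).const_mul (p.eval x)).congr_deriv ?_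
    simp
    ring

theorem pv_quot (s : ℝ) (m : ℕ) (f : Polynomial ℝ) (hf : f.natDegree ≤ m + 1) :
    ∃ g : Polynomial ℝ, g.natDegree ≤ m ∧ g.coeff m = f.coeff (m + 1) ∧
      f = Polynomial.C (f.eval s) + (Polynomial.X - Polynomial.C s) * g := by
  have h1 := Polynomial.modByMonic_add_div f (Polynomial.X - Polynomial.C s)
  rw [Polynomial.modByMonic_X_sub_C_eq_C_eval] at h1
  have h2 : (f /ₘ (Polynomial.X - Polynomial.C s)).natDegree ≤ m := by
    rw [Polynomial.natDegree_divByMonic _ (Polynomial.monic_X_sub_C s),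
      Polynomial.natDegree_X_sub_C]
    omega
  refine ⟨_, h2, ?_, h1.symm⟩
  have h3 := congrArg (fun q => Polynomial.coeff q (m + 1)) h1
  simp only [Polynomial.coeff_add, Polynomial.coeff_C_succ, sub_mul, Polynomial.coeff_sub,
    Polynomial.coeff_X_mul, Polynomial.coeff_C_mul] at h3
  rw [Polynomial.coeff_eq_zero_of_natDegree_lt (n := m + 1) (by omega)] at h3
  linarith

theorem pv_quad (s : ℝ) (m : ℕ) (L N : Polynomial ℝ →ₗ[ℝ] ℝ)
    (hN : ∀ p, N ((Polynomial.X - Polynomial.C s) * p) = L p)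
    (P Q : Polynomial ℝ) (hPd : P.natDegree ≤ m + 1) (hP1 : P.coeff (m + 1) = 1)
    (hQd : Q.natDegree ≤ m)
    (hP : ∀ f : Polynomial ℝ, f.natDegree ≤ m → L (P * f) = 0)
    (hQ : ∀ f : Polynomial ℝ, f.natDegree ≤ m → L (Q * f) = f.coeff m) :
    N (P * P) * N (Q * Q) = N (P * Q) * (N (P * Q) - 1) := by
  obtain ⟨g, g1, g2, g3⟩ := pv_quot s m P hPd
  obtain ⟨k, k1, k2, k3⟩ := pv_quot s m Q (by omega)
  rw [hP1] at g2
  rw [Polynomial.coeff_eq_zero_of_natDegree_lt (n := m + 1) (by omega)] at k2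
  have key : ∀ R f g : Polynomial ℝ, ∀ c : ℝ,
      f = Polynomial.C c + (Polynomial.X - Polynomial.C s) * g →
      N (R * f) = c * N R + L (R * g) := by
    intro R f g c h
    rw [h, show R * (Polynomial.C c + (Polynomial.X - Polynomial.C s) * g)
      = c • R + (Polynomial.X - Polynomial.C s) * (R * g) by
        rw [Polynomial.smul_eq_C_mul]; ring, map_add, map_smul, hN, smul_eq_mul]
  have e1 := key P P g _ g3
  have e2 := key P Q k _ k3
  have e3 := key Q P g _ g3
  have e4 := key Q Q k _ k3
  rw [hP _ g1] at e1
  rw [hP _ k1] at e2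
  rw [hQ _ g1, g2, mul_comm Q P] at e3
  rw [hQ _ k1, k2] at e4
  rw [e1, e4]
  have : N (P * Q) - 1 = P.eval s * N Q := by linarith
  rw [this, e2]
  ring

theorem pv_core (α lam t : ℝ) (m : ℕ) (L N Z : Polynomial ℝ →ₗ[ℝ] ℝ)
    (hN : ∀ p, N ((Polynomial.X + Polynomial.C t) * p) = L p)
    (hZ : ∀ p, Z (Polynomial.X * p) = L p)
    (hI : ∀ p, L (Polynomial.derivative p) + lam * N p + α * Z p - L p = 0)
    (P Q : Polynomial ℝ) (hPd : P.natDegree ≤ m + 1) (hP1 : P.coeff (m + 1) = 1)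
    (hQd : Q.natDegree ≤ m)
    (hP : ∀ f : Polynomial ℝ, f.natDegree ≤ m → L (P * f) = 0)
    (hQ : ∀ f : Polynomial ℝ, f.natDegree ≤ m → L (Q * f) = f.coeff m) :
    L (P * P) * Q.coeff m = - P.coeff m - lam * t * N (P * Q) ∧
    (lam * (N (P * P) * Q.coeff m - L (P * P) * N (Q * Q))) ^ 2
      = (L (P * P) * Q.coeff m - (m + 1) * (m + 1 + α)
          - lam * N (P * Q) * (2 * (m + 1) + α + lam)) ^ 2
        - 4 * (lam * N (P * Q)) * (lam * N (P * Q) - lam) * (L (P * P) * Q.coeff m) := by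
  have qN := pv_quad (-t) m L N (by simpa using hN) P Q hPd hP1 hQd hP hQ
  have qZ := pv_quad 0 m L Z (by simpa using hZ) P Q hPd hP1 hQd hP hQ
  have dP : (Polynomial.derivative P).natDegree ≤ m := by
    have := Polynomial.natDegree_derivative_le P
    omega
  have dQ : (Polynomial.derivative Q).natDegree ≤ m := by
    have := Polynomial.natDegree_derivative_le Q
    omega
  have Q0 : Q.coeff (m + 1) = 0 := Polynomial.coeff_eq_zero_of_natDegree_lt (by omega)
  have i1 := hI (P * P)
  have i2 := hI (P * Q)
  have i3 := hI (Q * Q)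
  have LPQ : L (P * Q) = 0 := hP _ hQd
  have LQQ : L (Q * Q) = Q.coeff m := hQ _ hQd
  rw [Polynomial.derivative_mul, mul_comm (Polynomial.derivative P) P, map_add, hP _ dP] at i1
  rw [Polynomial.derivative_mul, mul_comm (Polynomial.derivative P) Q, map_add, hP _ dQ,
    hQ _ dP, Polynomial.coeff_derivative, hP1, LPQ] at i2
  rw [Polynomial.derivative_mul, mul_comm (Polynomial.derivative Q) Q, map_add,
    hQ _ dQ, Polynomial.coeff_derivative, Q0, LQQ] at i3
  have i4 := hI (Polynomial.X * (P * Q))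
  have cX : ∀ f : Polynomial ℝ, ∀ j, (Polynomial.X * Polynomial.derivative f).coeff j
      = j * f.coeff j := by
    intro f j
    cases j with
    | zero => simp
    | succ j => rw [Polynomial.coeff_X_mul, Polynomial.coeff_derivative]; push_cast; ring
  have e1 : L (P * (Polynomial.X * Polynomial.derivative Q)) = 0 := by
    apply hP
    rw [Polynomial.natDegree_le_iff_coeff_eq_zero]
    intro j hj
    rw [cX, Polynomial.coeff_eq_zero_of_natDegree_lt (by omega), mul_zero]
  have e2 : L (Q * (Polynomial.X * Polynomial.derivative P)) = - P.coeff m := by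
    have h := hQ (Polynomial.X * Polynomial.derivative P - ((m : ℝ) + 1) • P) (by
      rw [Polynomial.natDegree_le_iff_coeff_eq_zero]
      intro j hj
      rw [Polynomial.coeff_sub, cX, Polynomial.coeff_smul, smul_eq_mul]
      rcases Nat.lt_or_ge (m + 1) j with h | h
      · rw [Polynomial.coeff_eq_zero_of_natDegree_lt (by omega)]; ring
      · have : j = m + 1 := by omega
        rw [this]; push_cast; ring)
    rw [mul_sub, map_sub, mul_smul_comm, map_smul, mul_comm Q P, LPQ, Polynomial.coeff_sub, cX,
      Polynomial.coeff_smul, smul_eq_mul, smul_eq_mul] at h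
    linarith
  have e3 : L (P * (Polynomial.X * Q)) = Q.coeff m * L (P * P) := by
    have h := hP (Polynomial.X * Q - Q.coeff m • P) (by
      rw [Polynomial.natDegree_le_iff_coeff_eq_zero]
      intro j hj
      obtain ⟨i, rfl⟩ : ∃ i, j = i + 1 := ⟨j - 1, by omega⟩
      rw [Polynomial.coeff_sub, Polynomial.coeff_X_mul, Polynomial.coeff_smul, smul_eq_mul]
      rcases Nat.lt_or_ge m i with h | h
      · rw [Polynomial.coeff_eq_zero_of_natDegree_lt (p := Q) (n := i) (by omega),
          Polynomial.coeff_eq_zero_of_natDegree_lt (p := P) (n := i + 1) (by omega)]; ring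
      · have : i = m := by omega
        rw [this, hP1]; ring)
    rw [mul_sub, map_sub, mul_smul_comm, map_smul, smul_eq_mul] at h
    linarith
  have e4 : N (Polynomial.X * (P * Q)) = - t * N (P * Q) := by
    have h := hN (P * Q)
    rw [LPQ, add_mul, map_add, ← Polynomial.smul_eq_C_mul, map_smul, smul_eq_mul] at h
    linarith
  have d : Polynomial.derivative (Polynomial.X * (P * Q)) = P * Q
      + Q * (Polynomial.X * Polynomial.derivative P)
      + P * (Polynomial.X * Polynomial.derivative Q) := by
    simp only [Polynomial.derivative_mul, Polynomial.derivative_X]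
    ring
  rw [d, map_add, map_add, LPQ, e1, e2, e4, hZ, LPQ,
    show Polynomial.X * (P * Q) = P * (Polynomial.X * Q) by ring, e3] at i4
  generalize L (P * P) = h at *
  generalize N (P * P) = a at *
  generalize N (P * Q) = b at *
  generalize N (Q * Q) = c at *
  generalize Z (P * P) = a0 at *
  generalize Z (P * Q) = b0 at *
  generalize Z (Q * Q) = c0 at *
  generalize Q.coeff m = k at *
  refine ⟨by linarith, ?_⟩
  have f1 : α * a0 = h - lam * a := by linarith
  have f2 : α * b0 = - (m + 1) - lam * b := by linarith
  have f3 : α * c0 = k - lam * c := by linarith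
  have f4 : (h - lam * a) * (k - lam * c)
      = (- (m + 1) - lam * b) * (- (m + 1) - lam * b - α) := by
    rw [← f1, ← f2, ← f3]
    linear_combination α ^ 2 * qZ
  have f5 : h * k - (m + 1) * (m + 1 + α) - lam * b * (2 * (m + 1) + α + lam)
      = lam * (h * c + k * a) := by
    linear_combination f4 - lam ^ 2 * qN
  rw [f5]
  linear_combination (-4 * lam ^ 2 * h * k) * qN

theorem pv_det_hasDerivAt {ι : Type*} [Fintype ι] [DecidableEq ι] (M : ℝ → Matrix ι ι ℝ)
    (M' : Matrix ι ι ℝ) (t : ℝ) (hM : ∀ i j, HasDerivAt (fun s => M s i j) (M' i j) t) :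
    HasDerivAt (fun s => (M s).det) (∑ i, ∑ j, (M t).adjugate i j * M' j i) t := by
  have h1 : HasDerivAt (fun s => ∑ σ : Equiv.Perm ι, ((Equiv.Perm.sign σ : ℤ) : ℝ) * ∏ i, M s (σ i) i)
      (∑ σ : Equiv.Perm ι, ((Equiv.Perm.sign σ : ℤ) : ℝ) *
        ∑ i, (∏ j ∈ Finset.univ.erase i, M t (σ j) j) • M' (σ i) i) t := by
    refine HasDerivAt.fun_sum fun σ _ => HasDerivAt.const_mul _ ?_
    exact HasDerivAt.fun_finsetProd fun i _ => hM (σ i) i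
  simp only [← Matrix.det_apply'] at h1
  refine h1.congr_deriv ?_
  have h2 : ∀ i, ∑ j, (M t).adjugate i j * M' j i
      = ∑ σ : Equiv.Perm ι, ((Equiv.Perm.sign σ : ℤ) : ℝ) *
        ((∏ j ∈ Finset.univ.erase i, M t (σ j) j) • M' (σ i) i) := by
    intro i
    have := congrFun (Matrix.cramer_eq_adjugate_mulVec (M t) (fun j => M' j i)) i
    rw [Matrix.cramer_apply, Matrix.det_apply'] at this
    rw [Matrix.mulVec, dotProduct] at this
    rw [← this]
    refine Finset.sum_congr rfl fun σ _ => ?_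
    congr 1
    rw [← Finset.prod_erase_mul _ _ (Finset.mem_univ i), smul_eq_mul, Matrix.updateCol_self]
    congr 1
    refine Finset.prod_congr rfl fun j hj => ?_
    rw [Matrix.updateCol_ne (Finset.ne_of_mem_erase hj)]
  simp only [h2, Finset.mul_sum]
  rw [Finset.sum_comm]

theorem pv_solve_hasDerivAt {ι : Type*} [Fintype ι] [DecidableEq ι] (M : ℝ → Matrix ι ι ℝ)
    (M' : Matrix ι ι ℝ) (t : ℝ) (hM : ∀ i j, HasDerivAt (fun s => M s i j) (M' i j) t)
    (v : ℝ → ι → ℝ) (v' : ι → ℝ) (hv : ∀ i, HasDerivAt (fun s => v s i) (v' i) t)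
    (hdet : (M t).det ≠ 0) :
    ∃ x' : ι → ℝ, (∀ i, HasDerivAt (fun s => ((M s)⁻¹.mulVec (v s)) i) (x' i) t) ∧
      ∀ i, ∑ j, M t i j * x' j = v' i - ∑ j, M' i j * ((M t)⁻¹.mulVec (v t)) j := by
  have hD := pv_det_hasDerivAt M M' t hM
  have hadj : ∀ i j, DifferentiableAt ℝ (fun s => (M s).adjugate i j) t := by
    intro i j
    simp only [Matrix.adjugate_apply]
    refine (pv_det_hasDerivAt (fun s => (M s).updateRow j (Pi.single i 1))
      (M'.updateRow j 0) t fun a b => ?_).differentiableAt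
    by_cases h : a = j
    · subst h
      simpa using hasDerivAt_const t _
    · simpa [Matrix.updateRow_ne h] using hM a b
  have hx : ∀ i, DifferentiableAt ℝ (fun s => ((M s)⁻¹.mulVec (v s)) i) t := by
    intro i
    simp only [Matrix.inv_def, Ring.inverse_eq_inv', Matrix.mulVec, dotProduct,
      Matrix.smul_apply, smul_eq_mul]
    refine DifferentiableAt.fun_sum fun j _ => ?_
    exact ((hD.differentiableAt.inv hdet).mul (hadj i j)).mul (hv j).differentiableAt
  refine ⟨fun i => deriv (fun s => ((M s)⁻¹.mulVec (v s)) i) t,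
    fun i => (hx i).hasDerivAt, fun i => ?_⟩
  have h1 : HasDerivAt (fun s => ∑ j, M s i j * ((M s)⁻¹.mulVec (v s)) j)
      (∑ j, (M' i j * ((M t)⁻¹.mulVec (v t)) j
        + M t i j * deriv (fun s => ((M s)⁻¹.mulVec (v s)) j) t)) t :=
    HasDerivAt.fun_sum fun j _ => (hM i j).mul (hx j).hasDerivAt
  have h2 : (fun s => ∑ j, M s i j * ((M s)⁻¹.mulVec (v s)) j) =ᶠ[𝓝 t] fun s => v s i := by
    filter_upwards [hD.continuousAt.eventually_ne hdet] with s hs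
    have : (M s).mulVec ((M s)⁻¹.mulVec (v s)) = v s := by
      rw [Matrix.mulVec_mulVec, Matrix.mul_nonsing_inv _ (isUnit_iff_ne_zero.2 hs),
        Matrix.one_mulVec]
    exact congrFun this i
  have h3 := (h1.congr_of_eventuallyEq h2.symm).unique (hv i)
  rw [Finset.sum_add_distrib] at h3
  linarith

/-- Hankel matrix of moments. -/
noncomputable def pvM (α lam : ℝ) (m : ℕ) (t : ℝ) : Matrix (Fin (m + 1)) (Fin (m + 1)) ℝ :=
  fun j k => pvF lam α t (Polynomial.X ^ ((j : ℕ) + (k : ℕ)))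

/-- Coefficients of the monic orthogonal polynomial. -/
noncomputable def pvc (α lam : ℝ) (m : ℕ) (t : ℝ) : Fin (m + 1) → ℝ :=
  (pvM α lam m t)⁻¹.mulVec fun j => - pvF lam α t (Polynomial.X ^ (m + 1 + (j : ℕ)))

/-- Coefficients of the dual polynomial of degree at most `m`. -/
noncomputable def pvd (α lam : ℝ) (m : ℕ) (t : ℝ) : Fin (m + 1) → ℝ :=
  (pvM α lam m t)⁻¹.mulVec (Pi.single (Fin.last m) 1)

/-- Polynomial of degree at most `m` with given coefficients. -/
noncomputable def pvPoly {m : ℕ} (c : Fin (m + 1) → ℝ) : Polynomial ℝ :=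
  ∑ j, c j • Polynomial.X ^ (j : ℕ)

theorem pvPoly_coeff {m : ℕ} (c : Fin (m + 1) → ℝ) (k : ℕ) :
    (pvPoly c).coeff k = if h : k < m + 1 then c ⟨k, h⟩ else 0 := by
  unfold pvPoly
  simp only [Polynomial.finsetSum_coeff, Polynomial.coeff_smul, Polynomial.coeff_X_pow,
    smul_eq_mul, mul_ite, mul_one, mul_zero]
  split_ifs with h
  · rw [Finset.sum_eq_single ⟨k, h⟩]
    · simp
    · intro j _ hj
      rw [if_neg]
      intro h2
      exact hj (Fin.ext h2.symm)
    · simp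
  · apply Finset.sum_eq_zero
    intro j _
    rw [if_neg]
    have := j.2
    omega

theorem pvPoly_natDegree {m : ℕ} (c : Fin (m + 1) → ℝ) : (pvPoly c).natDegree ≤ m := by
  rw [Polynomial.natDegree_le_iff_coeff_eq_zero]
  intro j hj
  rw [pvPoly_coeff, dif_neg (by omega)]

theorem pvPoly_of {m : ℕ} (f : Polynomial ℝ) (hf : f.natDegree ≤ m) :
    f = pvPoly (m := m) fun j => f.coeff j := by
  ext k
  rw [pvPoly_coeff]
  split_ifs with h
  · rfl
  · exact Polynomial.coeff_eq_zero_of_natDegree_lt (by omega)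

theorem pvPoly_last {m : ℕ} (c : Fin (m + 1) → ℝ) : (pvPoly c).coeff m = c (Fin.last m) := by
  rw [pvPoly_coeff, dif_pos (by omega)]
  rfl

theorem pvPoly_map {m : ℕ} (c : Fin (m + 1) → ℝ) (L : Polynomial ℝ →ₗ[ℝ] ℝ)
    (R : Polynomial ℝ) :
    L (R * pvPoly c) = ∑ j, c j * L (R * Polynomial.X ^ (j : ℕ)) := by
  unfold pvPoly
  rw [Finset.mul_sum, map_sum]
  refine Finset.sum_congr rfl fun j _ => ?_
  rw [mul_smul_comm, map_smul, smul_eq_mul]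

theorem pv_sum_aux (m : ℕ) (a : ℝ) :
    ∑ j : Fin (m + 1), (2 * ((j : ℕ) : ℝ) + 1 + a) = (m + 1) * (m + 1 + a) := by
  induction m with
  | zero => simp
  | succ m ih =>
    rw [Fin.sum_univ_castSucc]
    simp only [Fin.val_castSucc, Fin.val_last]
    rw [ih]
    push_cast
    ring

theorem pv_symm_swap {ι : Type*} [Fintype ι] (M : Matrix ι ι ℝ) (hM : ∀ i j, M i j = M j i)
    (x y : ι → ℝ) : ∑ i, x i * ∑ j, M i j * y j = ∑ i, y i * ∑ j, M i j * x j := by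
  simp only [Finset.mul_sum]
  rw [Finset.sum_comm]
  refine Finset.sum_congr rfl fun i _ => Finset.sum_congr rfl fun j _ => ?_
  rw [hM j i]
  ring

/-- Trace identity. -/
theorem pv_trace (α lam : ℝ) (m : ℕ) (t : ℝ) (ht : 0 < t) (hα : 0 < α)
    (hdet : (pvM α lam m t).det ≠ 0) :
    t * ∑ i, ∑ j, (pvM α lam m t).adjugate i j *
      (lam * pvF (lam - 1) α t (Polynomial.X ^ ((j : ℕ) + (i : ℕ))))
    = (pvM α lam m t).det *
      ((m + 1) * (m + 1 + α + lam) + pvc α lam m t (Fin.last m)) := by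
  have hrec : ∀ k : ℕ, t * (lam * pvF (lam - 1) α t (Polynomial.X ^ k))
      = (k + 1 + α + lam) * pvF lam α t (Polynomial.X ^ k)
        - pvF lam α t (Polynomial.X ^ (k + 1)) := by
    intro k
    have h1 := pvF_ibp lam α t ht hα (Polynomial.X ^ (k + 1))
    have h2 := pvF_Xt lam α t ht (Polynomial.X ^ k)
    have h3 := pvF_X lam α t (Polynomial.X ^ k)
    rw [add_mul, pvF_add _ _ _ ht (by linarith), ← Polynomial.smul_eq_C_mul, pvF_smul,
      ← pow_succ'] at h2
    rw [← pow_succ'] at h3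
    have h4 : Polynomial.derivative (Polynomial.X ^ (k + 1) : Polynomial ℝ)
        = ((k : ℝ) + 1) • Polynomial.X ^ k := by
      rw [Polynomial.derivative_X_pow, Polynomial.smul_eq_C_mul]
      simp
    rw [h4, pvF_smul, h3] at h1
    linear_combination lam * h2 - h1
  set M := pvM α lam m t with hMdef
  set A := M⁻¹ with hA
  have hadj : ∀ i j, M.adjugate i j = M.det * A i j := by
    intro i j
    rw [hA, Matrix.inv_def, Ring.inverse_eq_inv', Matrix.smul_apply, smul_eq_mul]
    field_simp
  have hAM : A * M = 1 := Matrix.nonsing_inv_mul _ (isUnit_iff_ne_zero.2 hdet)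
  have hMA : M * A = 1 := Matrix.mul_nonsing_inv _ (isUnit_iff_ne_zero.2 hdet)
  have s1 : ∀ i k, ∑ j, A i j * M j k = (1 : Matrix (Fin (m + 1)) (Fin (m + 1)) ℝ) i k := by
    intro i k
    rw [← hAM, Matrix.mul_apply]
  have s2 : ∀ j k, ∑ i, A i j * M k i = (1 : Matrix (Fin (m + 1)) (Fin (m + 1)) ℝ) k j := by
    intro j k
    rw [← hMA, Matrix.mul_apply]
    exact Finset.sum_congr rfl fun i _ => mul_comm _ _
  have s3 : ∑ i : Fin (m + 1), ∑ j : Fin (m + 1), A i j *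
      pvF lam α t (Polynomial.X ^ ((j : ℕ) + (i : ℕ) + 1)) = - pvc α lam m t (Fin.last m) := by
    rw [Fin.sum_univ_castSucc]
    have z : ∀ i : Fin m, ∑ j : Fin (m + 1), A i.castSucc j *
        pvF lam α t (Polynomial.X ^ ((j : ℕ) + (i.castSucc : ℕ) + 1)) = 0 := by
      intro i
      have := s1 i.castSucc i.succ
      rw [Matrix.one_apply_ne (Fin.castSucc_lt_succ).ne] at this
      exact this
    rw [Finset.sum_eq_zero fun i _ => z i, zero_add]
    unfold pvc
    rw [Matrix.mulVec, dotProduct, ← Finset.sum_neg_distrib]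
    refine Finset.sum_congr rfl fun j _ => ?_
    rw [mul_neg, neg_neg, Fin.val_last, show (j : ℕ) + m + 1 = m + 1 + j by ring]
  calc _ = ∑ i : Fin (m + 1), ∑ j : Fin (m + 1), M.det * (((i : ℕ) : ℝ) * (A i j * M j i)
        + ((j : ℕ) : ℝ) * (A i j * M j i) + (1 + (α + lam)) * (A i j * M j i)
        - A i j * pvF lam α t (Polynomial.X ^ ((j : ℕ) + (i : ℕ) + 1))) := by
        simp only [Finset.mul_sum]
        refine Finset.sum_congr rfl fun i _ => Finset.sum_congr rfl fun j _ => ?_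
        rw [hadj]
        have := hrec (j + i)
        push_cast at this
        rw [show M j i = pvF lam α t (Polynomial.X ^ ((j : ℕ) + (i : ℕ))) from rfl]
        linear_combination M.det * A i j * this
    _ = M.det * (∑ i : Fin (m + 1), ((i : ℕ) : ℝ) * ∑ j, A i j * M j i
        + ∑ j : Fin (m + 1), ((j : ℕ) : ℝ) * ∑ i, A i j * M j i
        + ∑ i : Fin (m + 1), (1 + (α + lam)) * ∑ j, A i j * M j i
        - ∑ i : Fin (m + 1), ∑ j : Fin (m + 1), A i j *
          pvF lam α t (Polynomial.X ^ ((j : ℕ) + (i : ℕ) + 1))) := by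
        simp only [← Finset.mul_sum, Finset.sum_add_distrib, Finset.sum_sub_distrib]
        congr 4
        simp only [Finset.mul_sum]
        rw [Finset.sum_comm]
    _ = _ := by
        rw [s3]
        simp only [s1, s2, Matrix.one_apply_eq]
        have := pv_sum_aux m (α + lam)
        simp only [add_assoc, Finset.sum_add_distrib, ← Finset.mul_sum] at this
        simp only [mul_one, sub_neg_eq_add]
        simp only [Finset.sum_add_distrib, Finset.sum_const, Finset.card_univ, Fintype.card_fin,
          nsmul_eq_mul] at this ⊢
        push_cast at this ⊢
        linear_combination M.det * this

/-- The monic orthogonal polynomial of degree `m + 1`. -/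
noncomputable def pvP (α lam : ℝ) (m : ℕ) (t : ℝ) : Polynomial ℝ :=
  Polynomial.X ^ (m + 1) + pvPoly (pvc α lam m t)

/-- The dual polynomial. -/
noncomputable def pvQ (α lam : ℝ) (m : ℕ) (t : ℝ) : Polynomial ℝ :=
  pvPoly (pvd α lam m t)

/-- The squared norm of `pvP`. -/
noncomputable def pvh (α lam : ℝ) (m : ℕ) (t : ℝ) : ℝ :=
  pvF lam α t (Polynomial.X ^ (2 * m + 2)) +
    ∑ j, pvc α lam m t j * pvF lam α t (Polynomial.X ^ (m + 1 + (j : ℕ)))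

theorem pv_map_P (α lam : ℝ) (m : ℕ) (t : ℝ) (L : Polynomial ℝ →ₗ[ℝ] ℝ) (R : Polynomial ℝ) :
    L (R * pvP α lam m t) = L (R * Polynomial.X ^ (m + 1))
      + ∑ j, pvc α lam m t j * L (R * Polynomial.X ^ (j : ℕ)) := by
  unfold pvP
  rw [mul_add, map_add, pvPoly_map]

theorem pv_mul_c (α lam : ℝ) (m : ℕ) (t : ℝ) (hdet : (pvM α lam m t).det ≠ 0)
    (i : Fin (m + 1)) : ∑ j, pvM α lam m t i j * pvc α lam m t j
      = - pvF lam α t (Polynomial.X ^ (m + 1 + (i : ℕ))) := by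
  have : (pvM α lam m t).mulVec (pvc α lam m t)
      = fun j : Fin (m + 1) => - pvF lam α t (Polynomial.X ^ (m + 1 + (j : ℕ))) := by
    unfold pvc
    rw [Matrix.mulVec_mulVec, Matrix.mul_nonsing_inv _ (isUnit_iff_ne_zero.2 hdet),
      Matrix.one_mulVec]
  exact congrFun this i

theorem pv_mul_d (α lam : ℝ) (m : ℕ) (t : ℝ) (hdet : (pvM α lam m t).det ≠ 0)
    (i : Fin (m + 1)) : ∑ j, pvM α lam m t i j * pvd α lam m t j
      = (Pi.single (Fin.last m) 1 : Fin (m + 1) → ℝ) i := by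
  have : (pvM α lam m t).mulVec (pvd α lam m t) = Pi.single (Fin.last m) 1 := by
    unfold pvd
    rw [Matrix.mulVec_mulVec, Matrix.mul_nonsing_inv _ (isUnit_iff_ne_zero.2 hdet),
      Matrix.one_mulVec]
  exact congrFun this i

theorem pv_orthP (α lam : ℝ) (m : ℕ) (t : ℝ) (ht : 0 < t) (hα : -1 < α)
    (hdet : (pvM α lam m t).det ≠ 0) (f : Polynomial ℝ) (hf : f.natDegree ≤ m) :
    pvL lam α t ht hα (pvP α lam m t * f) = 0 := by
  rw [pvPoly_of f hf, pvPoly_map]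
  refine Finset.sum_eq_zero fun i _ => ?_
  rw [mul_comm (pvP α lam m t), pv_map_P]
  have h1 := pv_mul_c α lam m t hdet i
  have h2 : ∑ j : Fin (m + 1), pvc α lam m t j *
      pvL lam α t ht hα (Polynomial.X ^ (i : ℕ) * Polynomial.X ^ (j : ℕ))
      = ∑ j, pvM α lam m t i j * pvc α lam m t j := by
    refine Finset.sum_congr rfl fun j _ => ?_
    rw [← pow_add, mul_comm]
    rfl
  rw [h2, h1, ← pow_add, add_comm (i : ℕ)]
  have : pvL lam α t ht hα (Polynomial.X ^ (m + 1 + (i : ℕ)))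
    = pvF lam α t (Polynomial.X ^ (m + 1 + (i : ℕ))) := rfl
  rw [this]
  ring

theorem pv_orthQ (α lam : ℝ) (m : ℕ) (t : ℝ) (ht : 0 < t) (hα : -1 < α)
    (hdet : (pvM α lam m t).det ≠ 0) (f : Polynomial ℝ) (hf : f.natDegree ≤ m) :
    pvL lam α t ht hα (pvQ α lam m t * f) = f.coeff m := by
  have h0 := pvPoly_last (m := m) fun j => f.coeff j
  rw [← pvPoly_of f hf] at h0
  conv_lhs => rw [pvPoly_of f hf, pvPoly_map]
  have : ∀ i : Fin (m + 1), pvL lam α t ht hα (pvQ α lam m t * Polynomial.X ^ (i : ℕ))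
      = (Pi.single (Fin.last m) 1 : Fin (m + 1) → ℝ) i := by
    intro i
    rw [← pv_mul_d α lam m t hdet i, mul_comm, pvQ, pvPoly_map]
    refine Finset.sum_congr rfl fun j _ => ?_
    rw [← pow_add, mul_comm]
    rfl
  simp only [this]
  simp [Pi.single_apply]

theorem pv_h_eq (α lam : ℝ) (m : ℕ) (t : ℝ) (ht : 0 < t) (hα : -1 < α)
    (hdet : (pvM α lam m t).det ≠ 0) :
    pvh α lam m t = pvF lam α t (pvP α lam m t * pvP α lam m t) := by
  have h1 := pv_orthP α lam m t ht hα hdet _ (pvPoly_natDegree (pvc α lam m t))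
  have h2 : pvL lam α t ht hα (pvP α lam m t * pvP α lam m t)
      = pvL lam α t ht hα (pvP α lam m t * Polynomial.X ^ (m + 1))
        + pvL lam α t ht hα (pvP α lam m t * pvPoly (pvc α lam m t)) := by
    rw [← map_add, ← mul_add]
    rfl
  rw [h1, add_zero, mul_comm (pvP α lam m t) (Polynomial.X ^ (m + 1)),
    pv_map_P α lam m t _ (Polynomial.X ^ (m + 1))] at h2
  refine Eq.trans ?_ h2.symm
  unfold pvh
  congr 1
  · rw [← pow_add, show m + 1 + (m + 1) = 2 * m + 2 by ring]
    rfl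
  · refine Finset.sum_congr rfl fun j _ => ?_
    rw [← pow_add]
    rfl

theorem pv_derivs (α lam : ℝ) (m : ℕ) (t : ℝ) (ht : 0 < t) (hα : -1 < α)
    (hdet : (pvM α lam m t).det ≠ 0) :
    HasDerivAt (fun s => pvc α lam m s (Fin.last m))
      (-(lam * pvF (lam - 1) α t (pvP α lam m t * pvQ α lam m t))) t ∧
    HasDerivAt (pvh α lam m)
      (lam * pvF (lam - 1) α t (pvP α lam m t * pvP α lam m t)) t ∧
    HasDerivAt (fun s => pvd α lam m s (Fin.last m))
      (-(lam * pvF (lam - 1) α t (pvQ α lam m t * pvQ α lam m t))) t := by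
  have hμ := fun k : ℕ => pvF_hasDerivAt lam α t ht hα (Polynomial.X ^ k)
  have hsym : ∀ i j, pvM α lam m t i j = pvM α lam m t j i := by
    intro i j
    unfold pvM
    rw [add_comm]
  have hM : ∀ i j : Fin (m + 1), HasDerivAt (fun s => pvM α lam m s i j)
      ((fun i j : Fin (m + 1) =>
        lam * pvF (lam - 1) α t (Polynomial.X ^ ((i : ℕ) + (j : ℕ)))) i j) t :=
    fun i j => hμ (i + j)
  obtain ⟨c', hc1, hc2⟩ := pv_solve_hasDerivAt (pvM α lam m) _ t hM
    (fun s j => - pvF lam α s (Polynomial.X ^ (m + 1 + (j : ℕ)))) _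
    (fun j => (hμ (m + 1 + j)).neg) hdet
  obtain ⟨d', hd1, hd2⟩ := pv_solve_hasDerivAt (pvM α lam m) _ t hM
    (fun _ => (Pi.single (Fin.last m) 1 : Fin (m + 1) → ℝ)) _
    (fun j => hasDerivAt_const t _) hdet
  change ∀ i, HasDerivAt (fun s => pvc α lam m s i) (c' i) t at hc1
  change ∀ i, HasDerivAt (fun s => pvd α lam m s i) (d' i) t at hd1
  set N := pvL (lam - 1) α t ht hα with hN
  have hNF : ∀ p, pvF (lam - 1) α t p = N p := fun p => rfl
  have hc3 : ∀ i, ∑ j, pvM α lam m t i j * c' j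
      = -(lam * N (pvP α lam m t * Polynomial.X ^ (i : ℕ))) := by
    intro i
    rw [hc2 i, mul_comm (pvP α lam m t), pv_map_P, mul_add, neg_add, sub_eq_add_neg,
      Finset.mul_sum]
    congr 1
    · rw [← pow_add, add_comm (i : ℕ)]; rfl
    · congr 1
      refine Finset.sum_congr rfl fun j _ => ?_
      rw [← pow_add, hNF]
      change _ * pvc α lam m t j = _
      ring
  have hd3 : ∀ i, ∑ j, pvM α lam m t i j * d' j
      = -(lam * N (pvQ α lam m t * Polynomial.X ^ (i : ℕ))) := by
    intro i
    rw [hd2 i, mul_comm (pvQ α lam m t), pvQ, pvPoly_map, zero_sub, Finset.mul_sum]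
    congr 1
    refine Finset.sum_congr rfl fun j _ => ?_
    rw [← pow_add, hNF]
    change _ * pvd α lam m t j = _
    ring
  have hlast : ∀ x : Fin (m + 1) → ℝ, x (Fin.last m)
      = ∑ i, pvd α lam m t i * ∑ j, pvM α lam m t i j * x j := by
    intro x
    rw [pv_symm_swap _ hsym]
    simp only [pv_mul_d α lam m t hdet]
    simp [Pi.single_apply]
  simp only [hNF]
  refine ⟨?_, ?_, ?_⟩
  · refine (hc1 (Fin.last m)).congr_deriv ?_
    rw [hlast c', pvQ, pvPoly_map, Finset.mul_sum, ← Finset.sum_neg_distrib]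
    refine Finset.sum_congr rfl fun i _ => ?_
    rw [hc3]
    ring
  · have h1 : HasDerivAt (pvh α lam m) (lam * N (Polynomial.X ^ (2 * m + 2)) +
        ∑ j : Fin (m + 1), (c' j * pvF lam α t (Polynomial.X ^ (m + 1 + (j : ℕ)))
          + pvc α lam m t j * (lam * N (Polynomial.X ^ (m + 1 + (j : ℕ)))))) t :=
      (hμ (2 * m + 2)).add (HasDerivAt.fun_sum fun j _ => (hc1 j).mul (hμ (m + 1 + j)))
    refine h1.congr_deriv ?_
    have h2 : ∑ j : Fin (m + 1), c' j * pvF lam α t (Polynomial.X ^ (m + 1 + (j : ℕ)))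
        = lam * ∑ j : Fin (m + 1), pvc α lam m t j * N (pvP α lam m t * Polynomial.X ^ (j : ℕ)) := by
      have := pv_symm_swap _ hsym c' (pvc α lam m t)
      simp only [pv_mul_c α lam m t hdet, hc3, mul_neg, Finset.sum_neg_distrib, neg_inj] at this
      rw [this, Finset.mul_sum]
      refine Finset.sum_congr rfl fun i _ => ?_
      ring
    rw [Finset.sum_add_distrib, h2, pv_map_P, mul_comm (pvP α lam m t) (Polynomial.X ^ (m + 1)),
      pv_map_P, ← pow_add, show m + 1 + (m + 1) = 2 * m + 2 by ring]
    simp only [← pow_add]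
    have h3 : ∑ j : Fin (m + 1), pvc α lam m t j * (lam * N (Polynomial.X ^ (m + 1 + (j : ℕ))))
        = lam * ∑ j : Fin (m + 1), pvc α lam m t j * N (Polynomial.X ^ (m + 1 + (j : ℕ))) := by
      rw [Finset.mul_sum]
      refine Finset.sum_congr rfl fun i _ => ?_
      ring
    rw [h3]
    ring
  · refine (hd1 (Fin.last m)).congr_deriv ?_
    rw [hlast d']
    have : N (pvQ α lam m t * pvQ α lam m t)
        = ∑ i, pvd α lam m t i * N (pvQ α lam m t * Polynomial.X ^ (i : ℕ)) :=
      pvPoly_map (pvd α lam m t) N (pvQ α lam m t)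
    rw [this, Finset.mul_sum, ← Finset.sum_neg_distrib]
    refine Finset.sum_congr rfl fun i _ => ?_
    rw [hd3]
    ring

theorem pv_point (α lam : ℝ) (m : ℕ) (t : ℝ) (ht : 0 < t) (hα : 0 < α)
    (hdet : (pvM α lam m t).det ≠ 0) :
    pvh α lam m t * pvd α lam m t (Fin.last m) = - pvc α lam m t (Fin.last m)
      - lam * t * pvF (lam - 1) α t (pvP α lam m t * pvQ α lam m t) ∧
    (lam * (pvF (lam - 1) α t (pvP α lam m t * pvP α lam m t) * pvd α lam m t (Fin.last m)
        - pvh α lam m t * pvF (lam - 1) α t (pvQ α lam m t * pvQ α lam m t))) ^ 2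
      = (pvh α lam m t * pvd α lam m t (Fin.last m) - (m + 1) * (m + 1 + α)
          - lam * pvF (lam - 1) α t (pvP α lam m t * pvQ α lam m t)
            * (2 * (m + 1) + α + lam)) ^ 2
        - 4 * (lam * pvF (lam - 1) α t (pvP α lam m t * pvQ α lam m t))
          * (lam * pvF (lam - 1) α t (pvP α lam m t * pvQ α lam m t) - lam)
          * (pvh α lam m t * pvd α lam m t (Fin.last m)) := by
  have hα' : -1 < α := by linarith
  have cP : (pvP α lam m t).coeff m = pvc α lam m t (Fin.last m) := by
    rw [pvP, Polynomial.coeff_add, pvPoly_last, Polynomial.coeff_X_pow, if_neg (by omega), zero_add]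
  have cQ : (pvQ α lam m t).coeff m = pvd α lam m t (Fin.last m) := pvPoly_last _
  have dpoly := pvPoly_natDegree (pvc α lam m t)
  have h := pv_core α lam t m (pvL lam α t ht hα') (pvL (lam - 1) α t ht hα')
    (pvL lam (α - 1) t ht (by linarith)) (pvF_Xt lam α t ht) (pvF_X lam α t)
    (pvF_ibp lam α t ht hα) (pvP α lam m t) (pvQ α lam m t)
    (by
      refine (Polynomial.natDegree_add_le _ _).trans (max_le ?_ (by omega))
      rw [Polynomial.natDegree_X_pow])
    (by
      rw [pvP, Polynomial.coeff_add, Polynomial.coeff_X_pow, if_pos rfl,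
        Polynomial.coeff_eq_zero_of_natDegree_lt (p := pvPoly _) (by omega), add_zero])
    (pvPoly_natDegree _) (pv_orthP α lam m t ht hα' hdet) (pv_orthQ α lam m t ht hα' hdet)
  rw [cP, cQ] at h
  rw [pv_h_eq α lam m t ht hα' hdet]
  exact h

/-- Chen–McKay: the logarithmic derivative `H_n(t) = t (d/dt) log D_n(t;α,λ)`
of the Hankel determinant for the perturbed Laguerre weight satisfies the
Jimbo–Miwa–Okamoto σ-form Painlevé V equation, with `δ_n = n + α + λ`. -/
theorem sigma_form_painleveV
    (n : ℕ) (hn : 1 ≤ n) (α lam : ℝ) (hα : 0 < α) (hsum : α + lam + 1 > 0)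
    (I : Set ℝ) (hIopen : IsOpen I) (hIsub : I ⊆ Set.Ioi (0 : ℝ))
    (D : ℝ → ℝ)
    (hD : ∀ t ∈ I, D t = Matrix.det (fun j k : Fin n =>
        ∫ x in Set.Ioi (0 : ℝ),
          x ^ ((j : ℕ) + (k : ℕ)) * ((x + t) ^ lam * x ^ α * Real.exp (-x))))
    (hDpos : ∀ t ∈ I, 0 < D t)
    (H : ℝ → ℝ)
    (hH : ∀ t ∈ I, H t = t * deriv (fun v => Real.log (D v)) t)
    (hHsmooth : ContDiffOn ℝ 2 H I) :
    ∀ t ∈ I,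
      (t * deriv (deriv H) t) ^ 2
        = (t * deriv H t + (n + (n + α + lam)) * deriv H t - H t + n * lam) ^ 2
          - 4 * deriv H t * (deriv H t + lam)
            * (t * deriv H t - H t + n * (n + α + lam)) := by
  obtain ⟨m, rfl⟩ : ∃ m, n = m + 1 := ⟨n - 1, by omega⟩
  have hα' : -1 < α := by linarith
  have hD2 : ∀ t ∈ I, D t = (pvM α lam m t).det := by
    intro t ht
    rw [hD t ht]
    congr 1
    funext j k
    unfold pvM pvF
    simp only [Polynomial.eval_pow, Polynomial.eval_X]
  have hdet : ∀ t ∈ I, (pvM α lam m t).det ≠ 0 := fun t ht => by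
    rw [← hD2 t ht]; exact (hDpos t ht).ne'
  have hpos : ∀ t ∈ I, 0 < t := fun t ht => hIsub ht
  have hev : ∀ t ∈ I, ∀ᶠ s in 𝓝 t, s ∈ I := fun t ht => hIopen.mem_nhds ht
  have hH2 : ∀ t ∈ I, H t = (m + 1) * (m + 1 + α + lam) + pvc α lam m t (Fin.last m) := by
    intro t ht
    have h1 := pv_det_hasDerivAt (pvM α lam m) _ t
      (fun i j => pvF_hasDerivAt lam α t (hpos t ht) hα' (Polynomial.X ^ ((i : ℕ) + (j : ℕ))))
    have h2 : HasDerivAt D _ t := h1.congr_of_eventuallyEq ((hev t ht).mono fun s hs => hD2 s hs)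
    have h3 := (h2.log (hDpos t ht).ne').deriv
    rw [hH t ht, h3, hD2 t ht, ← mul_div_assoc, pv_trace α lam m t (hpos t ht) hα (hdet t ht),
      mul_div_cancel_left₀ _ (hdet t ht)]
  have hH' : ∀ t ∈ I, HasDerivAt H
      (-(lam * pvF (lam - 1) α t (pvP α lam m t * pvQ α lam m t))) t := by
    intro t ht
    have h1 := (pv_derivs α lam m t (hpos t ht) hα' (hdet t ht)).1
    have h2 := h1.const_add (((m : ℝ) + 1) * (m + 1 + α + lam))
    exact h2.congr_of_eventuallyEq ((hev t ht).mono fun s hs => hH2 s hs)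
  have hE : ∀ t ∈ I, pvh α lam m t * pvd α lam m t (Fin.last m)
      = t * deriv H t - H t + (m + 1) * (m + 1 + α + lam) := by
    intro t ht
    have h1 := (pv_point α lam m t (hpos t ht) hα (hdet t ht)).1
    rw [(hH' t ht).deriv, h1, hH2 t ht]
    ring
  intro t ht
  obtain ⟨-, dh, dd⟩ := pv_derivs α lam m t (hpos t ht) hα' (hdet t ht)
  obtain ⟨-, hq⟩ := pv_point α lam m t (hpos t ht) hα (hdet t ht)
  have hdiff : DifferentiableAt ℝ (deriv H) t := by
    have h1 : DifferentiableAt ℝ (fun s => (pvh α lam m s * pvd α lam m s (Fin.last m) + H s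
        - (m + 1) * (m + 1 + α + lam)) / s) t :=
      (((dh.mul dd).differentiableAt.add (hH' t ht).differentiableAt).sub_const _).div
        differentiableAt_fun_id (hpos t ht).ne'
    refine h1.congr_of_eventuallyEq ((hev t ht).mono fun s hs => ?_)
    have hs0 := (hpos s hs).ne'
    simp only [hE s hs]
    field_simp
    ring
  have h1 : HasDerivAt (fun s => s * deriv H s - H s + (m + 1) * (m + 1 + α + lam))
      (1 * deriv H t + t * deriv (deriv H) t - deriv H t) t :=
    (((hasDerivAt_id t).mul hdiff.hasDerivAt).sub
      (hH' t ht).differentiableAt.hasDerivAt).add_const _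
  have h2 := (h1.congr_of_eventuallyEq ((hev t ht).mono fun s hs => hE s hs)).unique (dh.mul dd)
  have h3 : t * deriv (deriv H) t
      = lam * (pvF (lam - 1) α t (pvP α lam m t * pvP α lam m t) * pvd α lam m t (Fin.last m)
        - pvh α lam m t * pvF (lam - 1) α t (pvQ α lam m t * pvQ α lam m t)) := by
    linear_combination h2
  rw [h3, hq, hE t ht]
  have h4 := (hH' t ht).deriv
  rw [show lam * pvF (lam - 1) α t (pvP α lam m t * pvQ α lam m t) = - deriv H t by
    rw [h4]; ring]
  push_cast
  ring
end

section
/- (Lemma 1, second identity.) Let n ≥ 1, α > 0, λ ∈ ℝ with α + λ + 1 > 0. Suppose on an open interval I ⊂ (0,∞) the Hankel determinant D_n(t;α,λ) is positive and differentiable in t, and set H_n(t) = t (d/dt) log D_n(t;α,λ). Then for t ∈ I, H_n′(t) = n + α γ_{n−1}(t)² π_{n−1}(0;t) ∫₀^∞ π_n(x;t) w(x,t)/x dx, where π_k(x;t) are the monic orthogonal polynomials with respect to w(x,t) = (x+t)^λ x^α e^{−x} and γ_{n−1}(t)² = 1/h_{n−1}(t). -/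
open MeasureTheory Set Finset

namespace Lag

/-- the moments -/
noncomputable def mom (lam a t : ℝ) (k : ℕ) : ℝ :=
  ∫ x in Set.Ioi (0 : ℝ), x ^ k * ((x + t) ^ lam * x ^ a * Real.exp (-x))

lemma bound_aux (lam t : ℝ) (ht : 0 < t) :
    ∃ C : ℝ, 0 < C ∧ ∀ x : ℝ, 0 < x → (x + t) ^ lam ≤ C * Real.exp (x / 2) := by
  rcases le_or_gt lam 0 with hl | hl
  · refine ⟨t ^ lam, by positivity, fun x hx => ?_⟩
    have h1 : (x + t) ^ lam ≤ t ^ lam :=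
      Real.rpow_le_rpow_of_nonpos ht (by linarith) hl
    have h2 : 1 ≤ Real.exp (x / 2) := Real.one_le_exp (by linarith)
    have h3 : 0 < t ^ lam := by positivity
    nlinarith
  · refine ⟨(2 * lam) ^ lam * Real.exp (t / 2), by positivity, fun x hx => ?_⟩
    have h1 : (x + t) / (2 * lam) ≤ Real.exp ((x + t) / (2 * lam)) := by
      linarith [Real.add_one_le_exp ((x + t) / (2 * lam))]
    have h2 := Real.rpow_le_rpow (by positivity) h1 hl.le
    rw [← Real.exp_mul, Real.div_rpow (by positivity) (by positivity),
      div_le_iff₀ (by positivity)] at h2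
    have h3 : (x + t) / (2 * lam) * lam = t / 2 + x / 2 := by field_simp; ring
    rw [h3, Real.exp_add] at h2
    linarith

lemma integ (lam a t : ℝ) (k : ℕ) (ha : -1 < a) (ht : 0 < t) :
    IntegrableOn (fun x : ℝ => x ^ k * ((x + t) ^ lam * x ^ a * Real.exp (-x))) (Set.Ioi 0) := by
  obtain ⟨C, hC, hb⟩ := bound_aux lam t ht
  have h1 := (integrableOn_rpow_mul_exp_neg_mul_rpow (p := 1) (s := k + a) (b := 1 / 2)
    (by have : (0:ℝ) ≤ k := k.cast_nonneg
        linarith) one_pos (by norm_num)).const_mul C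
  refine Integrable.mono' h1 ?_ ?_
  · refine ContinuousOn.aestronglyMeasurable ?_ measurableSet_Ioi
    intro x hx
    have hx : 0 < x := hx
    refine ContinuousAt.continuousWithinAt ?_
    refine (continuousAt_id.pow k).mul (((?_ : ContinuousAt _ x).mul ?_).mul ?_)
    · exact (continuousAt_id.add continuousAt_const).rpow_const (Or.inl (by simp; linarith))
    · exact continuousAt_id.rpow_const (Or.inl (by simpa using hx.ne'))
    · fun_prop
  · refine (ae_restrict_iff' measurableSet_Ioi).2 (Filter.Eventually.of_forall fun x hx => ?_)
    have hx : 0 < x := hx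
    have hxt : 0 < x + t := by linarith
    rw [Real.norm_of_nonneg (by positivity), Real.rpow_add hx, Real.rpow_natCast, Real.rpow_one]
    have h2 : Real.exp (-x) = Real.exp (-(x/2)) * Real.exp (-(x/2)) := by
      rw [← Real.exp_add]; congr 1; ring
    have h3 : Real.exp (x/2) * Real.exp (-(x/2)) = 1 := by
      rw [← Real.exp_add]; simp
    have h4 : -(1/2) * x = -(x/2) := by ring
    rw [h2, h4]
    calc x ^ k * ((x + t) ^ lam * x ^ a * (Real.exp (-(x/2)) * Real.exp (-(x/2))))
        ≤ x ^ k * ((C * Real.exp (x / 2)) * x ^ a * (Real.exp (-(x/2)) * Real.exp (-(x/2)))) := by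
          gcongr
          exact hb x hx
      _ = C * (x ^ k * x ^ a * Real.exp (-(x/2))) * (Real.exp (x/2) * Real.exp (-(x/2))) := by ring
      _ = _ := by rw [h3, mul_one]

lemma mom_shift (lam a t : ℝ) (k : ℕ) : mom lam a t (k + 1) = mom lam (a + 1) t k := by
  refine setIntegral_congr_fun measurableSet_Ioi fun x hx => ?_
  have hx : 0 < x := hx
  simp only [Real.rpow_add hx, Real.rpow_one]
  ring

lemma mom_split (lam a t : ℝ) (k : ℕ) (ha : -1 < a) (ht : 0 < t) :
    t * mom (lam - 1) a t k + mom (lam - 1) a t (k + 1) = mom lam a t k := by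
  unfold mom
  rw [← integral_const_mul, ← integral_add ((integ _ _ _ _ ha ht).const_mul t) (integ _ _ _ _ ha ht)]
  refine setIntegral_congr_fun measurableSet_Ioi fun x hx => ?_
  have hx : 0 < x := hx
  have hxt : 0 < x + t := by linarith
  have : (x + t) ^ lam = (x + t) ^ (lam - 1) * (x + t) := by
    rw [Real.rpow_sub_one hxt.ne']; field_simp
  simp only [this]
  ring

lemma mom_deriv (lam a t : ℝ) (k : ℕ) (ha : -1 < a) (ht : 0 < t) :
    HasDerivAt (fun u => mom lam a u k) (lam * mom (lam - 1) a t k) t := by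
  have key := hasDerivAt_integral_of_dominated_loc_of_deriv_le
    (μ := volume.restrict (Set.Ioi (0:ℝ)))
    (F := fun u x => x ^ k * ((x + u) ^ lam * x ^ a * Real.exp (-x)))
    (F' := fun u x => lam * (x ^ k * ((x + u) ^ (lam - 1) * x ^ a * Real.exp (-x))))
    (x₀ := t) (s := Set.Ioo (t / 2) (2 * t))
    (bound := fun x => |lam| * (x ^ k * ((x + t / 2) ^ (lam - 1) * x ^ a * Real.exp (-x))
      + x ^ k * ((x + 2 * t) ^ (lam - 1) * x ^ a * Real.exp (-x))))
    (Ioo_mem_nhds (by linarith) (by linarith))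
    (by
      filter_upwards [lt_mem_nhds ht] with u hu
      exact (integ lam a u k ha hu).aestronglyMeasurable)
    (integ lam a t k ha ht)
    ((integ (lam - 1) a t k ha ht).const_mul lam).aestronglyMeasurable
    (by
      refine (ae_restrict_iff' measurableSet_Ioi).2 (Filter.Eventually.of_forall fun x hx u hu => ?_)
      have hx : 0 < x := hx
      obtain ⟨hu1, hu2⟩ := hu
      have hxt : 0 < x + t := by linarith
      have hxu : 0 < x + u := by linarith
      have h1 : (x + u) ^ (lam - 1) ≤ (x + t / 2) ^ (lam - 1) + (x + 2 * t) ^ (lam - 1) := by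
        have p1 : 0 < (x + t / 2) ^ (lam - 1) := by positivity
        have p2 : 0 < (x + 2 * t) ^ (lam - 1) := by positivity
        rcases le_or_gt (lam - 1) 0 with hl | hl
        · have := Real.rpow_le_rpow_of_nonpos (x := x + t / 2) (y := x + u) (by positivity) (by linarith) hl
          linarith
        · have := Real.rpow_le_rpow (x := x + u) (y := x + 2 * t) (by positivity) (by linarith) hl.le
          linarith
      rw [norm_mul, Real.norm_eq_abs, Real.norm_of_nonneg (by positivity)]
      gcongr
      calc _ ≤ x ^ k * (((x + t / 2) ^ (lam - 1) + (x + 2 * t) ^ (lam - 1)) * x ^ a * Real.exp (-x)) := by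
            gcongr
        _ = _ := by ring)
    (((integ _ a _ k ha (by linarith)).add (integ _ a _ k ha (by linarith))).const_mul _)
    (by
      refine (ae_restrict_iff' measurableSet_Ioi).2 (Filter.Eventually.of_forall fun x hx u hu => ?_)
      have hx : 0 < x := hx
      have hxu : 0 < x + u := by linarith [hu.1]
      have h1 : HasDerivAt (fun u => (x + u) ^ lam) (lam * (x + u) ^ (lam - 1)) u := by
        have := ((hasDerivAt_id u).const_add x).rpow_const (p := lam) (Or.inl hxu.ne')
        simpa using this
      have := ((h1.mul_const (x ^ a)).mul_const (Real.exp (-x))).const_mul (x ^ k)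
      refine this.congr_deriv ?_
      ring)
  have := key.2
  rw [integral_const_mul] at this
  exact this

lemma mom_ibp (lam a t : ℝ) (k : ℕ) (ha : 0 < a) (ht : 0 < t) :
    lam * mom (lam - 1) a t k
      = mom lam a t k - a * mom lam (a - 1) t k - k * mom lam a t (k - 1) := by
  have i1 := (integ (lam - 1) a t k (by linarith) ht).const_mul lam
  have i2 := integ lam a t k (by linarith) ht
  have i3 := (integ lam (a - 1) t k (by linarith) ht).const_mul a
  have i4 := (integ lam a t (k - 1) (by linarith) ht).const_mul (k : ℝ)
  have key := integral_Ioi_of_hasDerivAt_of_tendsto (a := (0 : ℝ)) (m := (0 : ℝ))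
    (f := fun x : ℝ => x ^ k * ((x + t) ^ lam * x ^ a * Real.exp (-x)))
    (f' := fun x : ℝ => lam * (x ^ k * ((x + t) ^ (lam - 1) * x ^ a * Real.exp (-x)))
      - x ^ k * ((x + t) ^ lam * x ^ a * Real.exp (-x))
      + a * (x ^ k * ((x + t) ^ lam * x ^ (a - 1) * Real.exp (-x)))
      + (k : ℝ) * (x ^ (k - 1) * ((x + t) ^ lam * x ^ a * Real.exp (-x))))
    (by
      refine ContinuousAt.continuousWithinAt ?_
      refine (continuousAt_id.pow k).mul (((?_ : ContinuousAt _ _).mul ?_).mul ?_)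
      · exact (continuousAt_id.add continuousAt_const).rpow_const (Or.inl (by simpa using ht.ne'))
      · exact continuousAt_id.rpow_const (Or.inr ha.le)
      · fun_prop)
    (by
      intro x hx
      have hx : 0 < x := hx
      have hxt : 0 < x + t := by linarith
      have h1 : HasDerivAt (fun x => (x + t) ^ lam) (lam * (x + t) ^ (lam - 1)) x := by
        have := ((hasDerivAt_id x).add_const t).rpow_const (p := lam) (Or.inl hxt.ne')
        simpa using this
      have h2 : HasDerivAt (fun x => x ^ a) (a * x ^ (a - 1)) x :=
        Real.hasDerivAt_rpow_const (Or.inl hx.ne')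
      have h3 : HasDerivAt (fun x => Real.exp (-x)) (-Real.exp (-x)) x := by
        simpa using (hasDerivAt_neg x).exp
      have := (hasDerivAt_pow k x).mul ((h1.mul h2).mul h3)
      refine this.congr_deriv ?_
      simp only [Pi.mul_apply]
      ring)
    (((i1.sub i2).add i3).add i4)
    (by
      obtain ⟨C, hC, hb⟩ := bound_aux lam t ht
      have hz := (tendsto_rpow_mul_exp_neg_mul_atTop_nhds_zero (k + a) (1/2) (by norm_num)).const_mul C
      rw [mul_zero] at hz
      refine squeeze_zero' ?_ ?_ hz
      · filter_upwards [Filter.eventually_gt_atTop 0] with x hx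
        have hxt : 0 < x + t := by linarith
        positivity
      · filter_upwards [Filter.eventually_gt_atTop 0] with x hx
        have hxt : 0 < x + t := by linarith
        rw [Real.rpow_add hx, Real.rpow_natCast]
        have h2 : Real.exp (-x) = Real.exp (-(x/2)) * Real.exp (-(x/2)) := by
          rw [← Real.exp_add]; congr 1; ring
        have h3 : Real.exp (x/2) * Real.exp (-(x/2)) = 1 := by
          rw [← Real.exp_add]; simp
        have h4 : -(1/2) * x = -(x/2) := by ring
        rw [h2, h4]
        calc x ^ k * ((x + t) ^ lam * x ^ a * (Real.exp (-(x/2)) * Real.exp (-(x/2))))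
            ≤ x ^ k * ((C * Real.exp (x / 2)) * x ^ a * (Real.exp (-(x/2)) * Real.exp (-(x/2)))) := by
              gcongr
              exact hb x hx
          _ = C * (x ^ k * x ^ a * Real.exp (-(x/2))) * (Real.exp (x/2) * Real.exp (-(x/2))) := by ring
          _ = _ := by rw [h3, mul_one])
  have e0 : (0 : ℝ) ^ a = 0 := Real.zero_rpow ha.ne'
  simp only [e0, mul_zero, zero_mul, sub_zero] at key
  have i12 : Integrable (fun x : ℝ => lam * (x ^ k * ((x + t) ^ (lam - 1) * x ^ a * Real.exp (-x)))
      - x ^ k * ((x + t) ^ lam * x ^ a * Real.exp (-x))) (volume.restrict (Set.Ioi 0)) := i1.sub i2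
  have i123 : Integrable (fun x : ℝ => lam * (x ^ k * ((x + t) ^ (lam - 1) * x ^ a * Real.exp (-x)))
      - x ^ k * ((x + t) ^ lam * x ^ a * Real.exp (-x))
      + a * (x ^ k * ((x + t) ^ lam * x ^ (a - 1) * Real.exp (-x))))
      (volume.restrict (Set.Ioi 0)) := i12.add i3
  rw [integral_add i123 i4, integral_add i12 i3, integral_sub i1 i2,
    integral_const_mul, integral_const_mul, integral_const_mul] at key
  unfold mom
  linarith

lemma mom_euler (lam a t : ℝ) (k : ℕ) (ha : 0 < a) (ht : 0 < t) :
    t * (lam * mom (lam - 1) a t k) = (lam + a + 1 + k) * mom lam a t k - mom lam a t (k + 1) := by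
  have h1 := mom_split lam a t k (by linarith) ht
  have h2 := mom_ibp lam a t (k + 1) ha ht
  have h3 := mom_shift lam (a - 1) t k
  rw [sub_add_cancel] at h3
  rw [h3] at h2
  simp only [Nat.add_sub_cancel] at h2
  push_cast at h2
  linear_combination lam * h1 - h2

end Lag

namespace Lag

open Polynomial in
/-- linear functional with given moments -/
noncomputable def Lf (m : ℕ → ℝ) : ℝ[X] →ₗ[ℝ] ℝ :=
  Polynomial.lsum (fun k => m k • LinearMap.id)

open Polynomial in
lemma Lf_sum (m : ℕ → ℝ) (q : ℝ[X]) (n : ℕ) (hq : q.natDegree < n) :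
    Lf m q = ∑ k ∈ Finset.range n, m k * q.coeff k := by
  simp only [Lf, Polynomial.lsum_apply]
  rw [Polynomial.sum_over_range' _ _ _ hq]
  · simp
  · simp

open Polynomial in
lemma Lf_X_pow (m : ℕ → ℝ) (k : ℕ) : Lf m (X ^ k) = m k := by
  rw [Lf_sum m (X ^ k) (k + 1) (by simp)]
  simp [Polynomial.coeff_X_pow]

open Polynomial in
lemma Lf_ext (L L' : ℝ[X] →ₗ[ℝ] ℝ) (h : ∀ k, L (X ^ k) = L' (X ^ k)) (q : ℝ[X]) : L q = L' q := by
  have : L = L' := by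
    apply Polynomial.lhom_ext'
    intro k
    ext
    simpa [Polynomial.monomial_one_right_eq_X_pow] using h k
  rw [this]

open Polynomial in
lemma integral_eq_Lf (W : ℝ → ℝ) (m : ℕ → ℝ)
    (hi : ∀ k : ℕ, IntegrableOn (fun x : ℝ => x ^ k * W x) (Set.Ioi 0))
    (hm : ∀ k : ℕ, ∫ x in Set.Ioi (0:ℝ), x ^ k * W x = m k) (q : ℝ[X]) :
    ∫ x in Set.Ioi (0:ℝ), q.eval x * W x = Lf m q := by
  rw [Lf_sum m q _ (Nat.lt_succ_self _)]
  simp_rw [Polynomial.eval_eq_sum_range, Finset.sum_mul]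
  rw [integral_finsetSum]
  · refine Finset.sum_congr rfl fun k _ => ?_
    rw [← hm k, mul_comm _ (q.coeff k), ← integral_const_mul]
    congr 1
    ext x
    ring
  · intro k _
    refine ((hi k).const_mul (q.coeff k)).congr (Filter.Eventually.of_forall fun x => ?_)
    simp only
    ring

open Polynomial in
lemma orth0 (L : ℝ[X] →ₗ[ℝ] ℝ) (P : ℕ → ℝ[X]) (hm : ∀ k, (P k).Monic)
    (hd : ∀ k, (P k).natDegree = k) (n : ℕ) (ho : ∀ k, k < n → L (P n * P k) = 0) :
    ∀ d : ℕ, d ≤ n → ∀ q : ℝ[X], q.degree < d → L (P n * q) = 0 := by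
  intro d
  induction d with
  | zero =>
    intro _ q hq
    have : q = 0 := by
      rw [← Polynomial.degree_eq_bot]
      exact Nat.WithBot.lt_zero_iff.1 (by simpa using hq)
    simp [this]
  | succ d ih =>
    intro hdn q hq
    have h1 : (q - C (q.coeff d) * P d).degree < d := by
      rw [Polynomial.degree_lt_iff_coeff_zero]
      intro j hj
      have hc : (P d).coeff d = 1 := by
        have := hm d
        rw [Polynomial.Monic, Polynomial.leadingCoeff, hd] at this
        exact this
      rcases hj.eq_or_lt with rfl | hlt
      · simp [hc]
      · have e1 : q.coeff j = 0 := by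
          apply Polynomial.coeff_eq_zero_of_degree_lt
          exact hq.trans_le (by exact_mod_cast hlt)
        have e2 : (P d).coeff j = 0 :=
          Polynomial.coeff_eq_zero_of_natDegree_lt (by rw [hd]; exact hlt)
        simp [e1, e2]
    have h2 := ih (by omega) _ h1
    have h3 : P n * q = P n * (q - C (q.coeff d) * P d) + (q.coeff d) • (P n * P d) := by
      rw [Polynomial.smul_eq_C_mul]; ring
    rw [h3, map_add, map_smul, h2, ho d (by omega)]
    simp

open Polynomial in
lemma orth1 (L : ℝ[X] →ₗ[ℝ] ℝ) (P : ℕ → ℝ[X]) (hm : ∀ k, (P k).Monic)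
    (hd : ∀ k, (P k).natDegree = k) (n : ℕ) (ho : ∀ k, k < n → L (P n * P k) = 0)
    (q : ℝ[X]) (hq : q.natDegree ≤ n) : L (P n * q) = q.coeff n * L (P n * P n) := by
  have hc : (P n).coeff n = 1 := by
    have := hm n
    rw [Polynomial.Monic, Polynomial.leadingCoeff, hd] at this
    exact this
  have h1 : (q - C (q.coeff n) * P n).degree < n := by
    rw [Polynomial.degree_lt_iff_coeff_zero]
    intro j hj
    rcases hj.eq_or_lt with rfl | hlt
    · simp [hc]
    · have e1 : q.coeff j = 0 :=
        Polynomial.coeff_eq_zero_of_natDegree_lt (by omega)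
      have e2 : (P n).coeff j = 0 :=
        Polynomial.coeff_eq_zero_of_natDegree_lt (by rw [hd]; exact hlt)
      simp [e1, e2]
  have h2 := orth0 L P hm hd n ho n le_rfl _ h1
  have h3 : P n * q = P n * (q - C (q.coeff n) * P n) + (q.coeff n) • (P n * P n) := by
    rw [Polynomial.smul_eq_C_mul]; ring
  rw [h3, map_add, map_smul, h2]
  simp

lemma hasDerivAt_det {n : ℕ} (M : ℝ → Matrix (Fin n) (Fin n) ℝ) (M' : Matrix (Fin n) (Fin n) ℝ)
    (t : ℝ) (hM : ∀ i j, HasDerivAt (fun u => M u i j) (M' i j) t) :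
    HasDerivAt (fun u => (M u).det) (Matrix.trace ((M t).adjugate * M')) t := by
  let f : ContinuousMultilinearMap ℝ (fun _ : Fin n => (Fin n → ℝ)) ℝ :=
    { (Matrix.detRowAlternating (R := ℝ) (n := Fin n)).toMultilinearMap with
      cont := by
        show Continuous (fun A : Fin n → Fin n → ℝ => Matrix.det (Matrix.of A))
        exact Continuous.matrix_det (by fun_prop) }
  have hM2 : HasDerivAt (fun u => (fun i => M u i : Fin n → Fin n → ℝ)) (fun i => M' i) t := by
    rw [hasDerivAt_pi]; intro i
    rw [hasDerivAt_pi]; intro j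
    exact hM i j
  have h := (f.hasFDerivAt (fun i => M t i)).comp_hasDerivAt t hM2
  refine h.congr_deriv ?_
  rw [ContinuousMultilinearMap.linearDeriv_apply]
  have h2 : ∀ i, f (Function.update (fun i => M t i) i (M' i)) = ∑ j, M' i j * (M t).adjugate j i := by
    intro i
    have : f (Function.update (fun i => M t i) i (M' i)) = ((M t).updateRow i (M' i)).det := rfl
    rw [this, ← Matrix.cramer_transpose_apply, Matrix.cramer_eq_adjugate_mulVec,
      ← Matrix.adjugate_transpose]
    simp [Matrix.mulVec, dotProduct, mul_comm]
  simp_rw [h2]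
  rw [Matrix.trace_mul_comm]
  simp [Matrix.trace, Matrix.mul_apply]

lemma trace_lemma (N : ℕ) (m m' : ℕ → ℝ) (t s : ℝ)
    (hm : ∀ k : ℕ, t * m' k = (s + k) * m k - m (k + 1)) (c : ℕ → ℝ)
    (hc : ∀ j : ℕ, j < N + 1 → ∑ i : Fin (N + 1), m (j + i) * c i = - m (j + N + 1)) :
    t * Matrix.trace ((Matrix.of fun j k : Fin (N + 1) => m (j + k)).adjugate *
        (Matrix.of fun j k : Fin (N + 1) => m' (j + k)))
      = ((N + 1 : ℝ) * (s + N) + c N) * (Matrix.of fun j k : Fin (N + 1) => m (j + k)).det := by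
  set M : Matrix (Fin (N + 1)) (Fin (N + 1)) ℝ := Matrix.of fun j k => m (j + k) with hMdef
  set M' : Matrix (Fin (N + 1)) (Fin (N + 1)) ℝ := Matrix.of fun j k => m' (j + k) with hM'def
  let Λ : Matrix (Fin (N + 1)) (Fin (N + 1)) ℝ := Matrix.diagonal fun j => ((j : ℕ) : ℝ)
  let B : Matrix (Fin (N + 1)) (Fin (N + 1)) ℝ := Matrix.of fun i k =>
    if (k : ℕ) = N then - c i else if (i : ℕ) = k + 1 then 1 else 0
  have hB : ∀ j k : Fin (N + 1), (M * B) j k = m (j + k + 1) := by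
    intro j k
    rw [Matrix.mul_apply]
    simp only [hMdef, B, Matrix.of_apply]
    by_cases hk : (k : ℕ) = N
    · simp only [hk, if_true, mul_neg, Finset.sum_neg_distrib]
      rw [hc j j.2]; simp
    · simp only [hk, if_false]
      have hk2 : (k : ℕ) + 1 < N + 1 := by have := k.2; omega
      rw [Finset.sum_eq_single ⟨k + 1, hk2⟩]
      · simp [add_assoc]
      · intro b _ hb
        have : (b : ℕ) ≠ k + 1 := fun h => hb (Fin.ext h)
        simp [this]
      · simp
  have hE : t • M' = s • M + Λ * M + M * Λ - M * B := by
    ext j k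
    rw [Matrix.sub_apply, hB]
    simp only [Matrix.smul_apply, Matrix.add_apply, Λ, Matrix.diagonal_mul, Matrix.mul_diagonal,
      hMdef, hM'def, Matrix.of_apply, smul_eq_mul]
    rw [hm]; push_cast; ring
  have h1 : t * Matrix.trace (M.adjugate * M') = Matrix.trace (M.adjugate * (t • M')) := by
    simp
  have tΛ : 2 * Matrix.trace Λ = (N + 1) * N := by
    simp only [Λ, Matrix.trace_diagonal]
    rw [Fin.sum_univ_eq_sum_range (fun i => (i : ℝ)) (N + 1)]
    clear * -
    induction N with
    | zero => simp
    | succ N ih => rw [Finset.sum_range_succ, mul_add, ih]; push_cast; ring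
  have tB : Matrix.trace B = - c N := by
    simp only [Matrix.trace, Matrix.diag_apply, B, Matrix.of_apply]
    rw [Finset.sum_eq_single (Fin.last N)]
    · simp
    · intro b _ hb
      have : (b : ℕ) ≠ N := fun h => hb (Fin.ext h)
      simp [this]
    · simp
  have e1 : M.adjugate * (M * Λ) = M.det • Λ := by
    rw [← Matrix.mul_assoc, Matrix.adjugate_mul, Matrix.smul_mul, Matrix.one_mul]
  have e2 : M.adjugate * (M * B) = M.det • B := by
    rw [← Matrix.mul_assoc, Matrix.adjugate_mul, Matrix.smul_mul, Matrix.one_mul]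
  have e3 : Matrix.trace (M.adjugate * (Λ * M)) = M.det * Matrix.trace Λ := by
    rw [← Matrix.mul_assoc, Matrix.trace_mul_comm, ← Matrix.mul_assoc, Matrix.mul_adjugate,
      Matrix.smul_mul, Matrix.one_mul, Matrix.trace_smul, smul_eq_mul]
  rw [h1, hE, Matrix.mul_sub, Matrix.mul_add, Matrix.mul_add, e1, e2, Matrix.mul_smul,
    Matrix.adjugate_mul, Matrix.trace_sub, Matrix.trace_add, Matrix.trace_add, e3]
  simp only [Matrix.trace_smul, Matrix.trace_one, Fintype.card_fin, tB, smul_eq_mul]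
  push_cast
  linear_combination M.det * tΛ

end Lag

namespace Lag

open Polynomial in
lemma Lf_mul (m : ℕ → ℝ) (q r : ℝ[X]) :
    Lf m (q * r) = Lf (fun j => Lf (fun k => m (j + k)) q) r := by
  refine Lf_ext (Lf m ∘ₗ LinearMap.mulLeft ℝ q) _ (fun j => ?_) r
  rw [Lf_X_pow]
  refine Lf_ext (Lf m ∘ₗ LinearMap.mulRight ℝ (X ^ j)) _ (fun k => ?_) q
  simp only [LinearMap.comp_apply, LinearMap.mulRight_apply]
  rw [Lf_X_pow, ← pow_add, Lf_X_pow, add_comm]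

open Polynomial in
/-- the algebraic identity at a fixed time -/
lemma alg_final (N : ℕ) (m m' nn : ℕ → ℝ) (α h : ℝ) (hh : 0 < h)
    (hm' : ∀ k : ℕ, m' k = m k - α * nn k - k * m (k - 1)) (hnn : ∀ k, nn (k + 1) = m k)
    (P : ℕ → ℝ[X]) (hmon : ∀ k, (P k).Monic) (hd : ∀ k, (P k).natDegree = k)
    (ho : ∀ j k, j ≠ k → Lf m (P j * P k) = 0) (hN : Lf m (P N * P N) = h)
    (c' : ℕ → ℝ)
    (hder : ∀ j, j < N + 1 → ∑ k ∈ Finset.range (N + 1),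
      (m' (j + k) * (P (N + 1)).coeff k + m (j + k) * c' k) + m' (j + (N + 1)) = 0) :
    c' N = (N + 1 : ℝ) + α * (1 / h) * (P N).eval 0 * Lf nn (P (N + 1)) := by
  set n := N + 1 with hn
  let q : ℝ[X] := ∑ k ∈ Finset.range n, C (c' k) * X ^ k
  have hqc : ∀ j, q.coeff j = if j < n then c' j else 0 := by
    intro j
    simp [q, Polynomial.coeff_C_mul, Polynomial.coeff_X_pow]
  have hqd : q.natDegree < n := by
    rw [Nat.lt_iff_le_pred (by omega)]
    rw [Polynomial.natDegree_le_iff_coeff_eq_zero]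
    intro j hj
    rw [hqc, if_neg (by omega)]
  have hcn : (P n).coeff n = 1 := by
    have := hmon n
    rw [Polynomial.Monic, Polynomial.leadingCoeff, hd] at this
    exact this
  have h0 : Lf m' (P n * P N) + Lf m (q * P N) = 0 := by
    rw [Lf_mul, Lf_mul, Lf_sum _ (P N) n (by rw [hd]; omega), Lf_sum _ (P N) n (by rw [hd]; omega),
      ← Finset.sum_add_distrib]
    refine Finset.sum_eq_zero fun j hj => ?_
    rw [← add_mul, Lf_sum _ (P n) (n + 1) (by rw [hd]; omega), Lf_sum _ q n hqd,
      Finset.sum_range_succ, hcn, mul_one]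
    have := hder j (Finset.mem_range.1 hj)
    rw [Finset.sum_add_distrib] at this
    have e : ∑ k ∈ Finset.range n, m (j + k) * q.coeff k = ∑ k ∈ Finset.range n, m (j + k) * c' k := by
      refine Finset.sum_congr rfl fun k hk => ?_
      rw [hqc, if_pos (Finset.mem_range.1 hk)]
    rw [e]
    have e2 : ∀ a b c d : ℝ, a + b + c = 0 → (a + c + b) * d = 0 := by
      intro a b c d h; rw [show a + c + b = a + b + c by ring, h, zero_mul]
    exact e2 _ _ _ _ this
  have h1 : Lf m (q * P N) = c' N * h := by
    rw [mul_comm, orth1 (Lf m) P hmon hd N (fun k hk => ho _ _ (by omega)) q (by omega), hqc,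
      if_pos (by omega), hN]
  have h2 : ∀ r : ℝ[X], Lf m' r = Lf m r - α * Lf nn r - Lf m (derivative r) := by
    intro r
    refine Lf_ext (Lf m') (Lf m - α • Lf nn - Lf m ∘ₗ derivative) (fun k => ?_) r
    simp only [LinearMap.sub_apply, LinearMap.smul_apply, LinearMap.comp_apply, Lf_X_pow,
      Polynomial.derivative_X_pow, smul_eq_mul]
    rw [Polynomial.C_mul', map_smul, Lf_X_pow, hm']
    simp
  have h3 : Lf m (P n * P N) = 0 := ho _ _ (by omega)
  have ho' : ∀ r : ℝ[X], r.natDegree < n → Lf m (P n * r) = 0 := fun r hr =>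
    orth0 (Lf m) P hmon hd n (fun k hk => ho _ _ (by omega)) n le_rfl r
      (lt_of_le_of_lt Polynomial.degree_le_natDegree (by exact_mod_cast hr))
  have h4 : Lf m (derivative (P n * P N)) = n * h := by
    rw [Polynomial.derivative_mul, map_add, mul_comm (derivative (P n)),
      orth1 (Lf m) P hmon hd N (fun k hk => ho _ _ (by omega)) _
        ((Polynomial.natDegree_derivative_le _).trans (by rw [hd]; omega)),
      ho' _ (lt_of_le_of_lt (Polynomial.natDegree_derivative_le _) (by rw [hd]; omega)), hN,
      Polynomial.coeff_derivative, hcn]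
    simp [hn]
  have h5 : Lf nn (P n * P N) = (P N).eval 0 * Lf nn (P n) := by
    have e : P n * P N = X * (P n * (P N).divX) + (P N).eval 0 • P n := by
      conv_lhs => rw [← Polynomial.divX_mul_X_add (P N)]
      rw [Polynomial.coeff_zero_eq_eval_zero, Polynomial.smul_eq_C_mul]
      ring
    have e2 : ∀ r : ℝ[X], Lf nn (X * r) = Lf m r := by
      intro r
      refine Lf_ext (Lf nn ∘ₗ LinearMap.mulLeft ℝ X) _ (fun k => ?_) r
      simp only [LinearMap.comp_apply, LinearMap.mulLeft_apply]
      rw [← pow_succ', Lf_X_pow, Lf_X_pow, hnn]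
    rw [e, map_add, map_smul, e2, ho' _ (by rw [Polynomial.natDegree_divX_eq_natDegree_tsub_one, hd]; omega)]
    simp
  rw [h2, h1, h3, h4, h5] at h0
  have hn' : (n : ℝ) = N + 1 := by simp [hn]
  rw [hn'] at h0
  field_simp
  linarith

end Lag

/-- Lemma 1, second identity: with
`H_n(t) = t (d/dt) log D_n(t;α,λ)` for the Hankel determinant of the perturbed Laguerre
weight `w(x,t) = (x+t)^λ x^α e^{−x}`, one has
`H_n′(t) = n + α γ_{n−1}(t)² π_{n−1}(0;t) ∫₀^∞ π_n(x;t) w(x,t)/x dx`. -/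
theorem lemma1_second_identity
    (n : ℕ) (hn : 1 ≤ n) (α lam : ℝ) (hα : 0 < α) (hsum : α + lam + 1 > 0)
    (I : Set ℝ) (hIopen : IsOpen I) (hIsub : I ⊆ Set.Ioi (0 : ℝ))
    (D : ℝ → ℝ)
    (hD : ∀ t ∈ I, D t = Matrix.det (fun j k : Fin n =>
        ∫ x in Set.Ioi (0 : ℝ),
          x ^ ((j : ℕ) + (k : ℕ)) * ((x + t) ^ lam * x ^ α * Real.exp (-x))))
    (hDpos : ∀ t ∈ I, 0 < D t)
    (hDdiff : ∀ t ∈ I, DifferentiableAt ℝ D t)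
    (p : ℕ → ℝ → Polynomial ℝ) (h : ℕ → ℝ → ℝ)
    (hmonic : ∀ k, ∀ t ∈ I, (p k t).Monic)
    (hdeg : ∀ k, ∀ t ∈ I, (p k t).natDegree = k)
    (hpos : ∀ k, ∀ t ∈ I, 0 < h k t)
    (horth : ∀ j k, ∀ t ∈ I,
      ∫ x in Set.Ioi (0 : ℝ),
          (p j t).eval x * (p k t).eval x * ((x + t) ^ lam * x ^ α * Real.exp (-x))
        = if j = k then h j t else 0) :
    ∀ t ∈ I,
      deriv (fun u => u * deriv (fun v => Real.log (D v)) u) t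
        = n + α * (1 / h (n - 1) t) * (p (n - 1) t).eval 0 *
            ∫ x in Set.Ioi (0 : ℝ),
              (p n t).eval x * ((x + t) ^ lam * x ^ α * Real.exp (-x)) / x := by
  obtain ⟨N, rfl⟩ : ∃ N, n = N + 1 := ⟨n - 1, by omega⟩
  simp only [Nat.add_sub_cancel]
  let M : ℝ → Matrix (Fin (N + 1)) (Fin (N + 1)) ℝ := fun u =>
    Matrix.of fun j k => Lag.mom lam α u (j + k)
  let m' : ℝ → ℕ → ℝ := fun u k => lam * Lag.mom (lam - 1) α u k
  let c : ℕ → ℝ → ℝ := fun k u => (p (N + 1) u).coeff k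
  have hDM : ∀ u ∈ I, D u = (M u).det := hD
  have hmd : ∀ u ∈ I, ∀ k, HasDerivAt (fun v => Lag.mom lam α v k) (m' u k) u := fun u hu k =>
    Lag.mom_deriv lam α u k (by linarith) (hIsub hu)
  have horth' : ∀ u ∈ I, ∀ j k, Lag.Lf (Lag.mom lam α u) (p j u * p k u)
      = if j = k then h j u else 0 := by
    intro u hu j k
    rw [← horth j k u hu, ← Lag.integral_eq_Lf (fun x => (x + u) ^ lam * x ^ α * Real.exp (-x)) (Lag.mom lam α u)
      (fun k => Lag.integ lam α u k (by linarith) (hIsub hu)) (fun k => rfl)]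
    simp [Polynomial.eval_mul]
  have hrel : ∀ u ∈ I, ∀ j, j < N + 1 → ∑ k ∈ Finset.range (N + 1),
      Lag.mom lam α u (j + k) * c k u + Lag.mom lam α u (j + (N + 1)) = 0 := by
    intro u hu j hj
    have h1 := Lag.orth0 (Lag.Lf (Lag.mom lam α u)) (fun k => p k u) (fun k => hmonic k u hu)
      (fun k => hdeg k u hu) (N + 1) (fun k hk => by rw [horth' u hu, if_neg (by omega)])
      (N + 1) le_rfl (Polynomial.X ^ j) (by rw [Polynomial.degree_X_pow]; exact_mod_cast hj)
    have hcn : (p (N + 1) u).coeff (N + 1) = 1 := by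
      have := hmonic (N + 1) u hu
      rw [Polynomial.Monic, Polynomial.leadingCoeff, hdeg _ u hu] at this
      exact this
    rw [Lag.Lf_mul, Lag.Lf_X_pow, Lag.Lf_sum _ _ (N + 1 + 1) (by rw [hdeg _ u hu]; omega),
      Finset.sum_range_succ, hcn, mul_one] at h1
    exact h1
  have hrelF : ∀ u ∈ I, ∀ j, j < N + 1 → ∑ k : Fin (N + 1),
      Lag.mom lam α u (j + k) * c k u = - Lag.mom lam α u (j + N + 1) := by
    intro u hu j hj
    rw [Fin.sum_univ_eq_sum_range (fun k => Lag.mom lam α u (j + k) * c k u) (N + 1)]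
    have := hrel u hu j hj
    rw [add_assoc j N 1]
    linarith
  -- differentiability of coefficients
  have hMd : ∀ u ∈ I, HasDerivAt (fun v => (M v).det) (Matrix.trace ((M u).adjugate *
      (Matrix.of fun j k : Fin (N + 1) => m' u (j + k)))) u := fun u hu =>
    Lag.hasDerivAt_det M _ u (fun i j => hmd u hu _)
  have hcd : ∀ u ∈ I, ∀ k, k < N + 1 → DifferentiableAt ℝ (c k) u := by
    intro u hu k hk
    let v : ℝ → Fin (N + 1) → ℝ := fun s j => - Lag.mom lam α s (j + N + 1)
    have e : ∀ s ∈ I, c k s = (Matrix.updateCol (M s) ⟨k, hk⟩ (v s)).det / (M s).det := by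
      intro s hs
      have hdet : (M s).det ≠ 0 := by rw [← hDM s hs]; exact (hDpos s hs).ne'
      have e1 : (M s).mulVec (fun i : Fin (N + 1) => c i s) = v s := by
        ext j
        exact hrelF s hs j j.2
      rw [← Matrix.cramer_apply, ← e1, Matrix.cramer_eq_adjugate_mulVec, Matrix.mulVec_mulVec,
        Matrix.adjugate_mul, Matrix.smul_mulVec, Matrix.one_mulVec]
      simp only [Pi.smul_apply, smul_eq_mul]
      field_simp
    have hdet : (M u).det ≠ 0 := by rw [← hDM u hu]; exact (hDpos u hu).ne'
    have hev : c k =ᶠ[nhds u] fun s => (Matrix.updateCol (M s) ⟨k, hk⟩ (v s)).det / (M s).det := by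
      filter_upwards [hIopen.mem_nhds hu] with s hs using e s hs
    refine DifferentiableAt.congr_of_eventuallyEq ?_ hev
    refine DifferentiableAt.div ?_ (hMd u hu).differentiableAt hdet
    refine (Lag.hasDerivAt_det (fun s => Matrix.updateCol (M s) ⟨k, hk⟩ (v s))
      (Matrix.of fun i j => if j = ⟨k, hk⟩ then - m' u (i + N + 1) else m' u (i + j)) u
      (fun i j => ?_)).differentiableAt
    simp only [Matrix.updateCol_apply, Matrix.of_apply]
    by_cases hj : j = ⟨k, hk⟩
    · simp only [hj, if_true]
      exact (hmd u hu _).neg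
    · simp only [hj, if_false]
      exact hmd u hu _
  -- the first identity
  have hH : ∀ u ∈ I, u * deriv (fun v => Real.log (D v)) u
      = (N + 1 : ℝ) * (lam + α + 1 + N) + c N u := by
    intro u hu
    have hu0 : 0 < u := hIsub hu
    have hDp := hDpos u hu
    have hdD : HasDerivAt D (Matrix.trace ((M u).adjugate *
      (Matrix.of fun j k : Fin (N + 1) => m' u (j + k)))) u := by
      refine (hMd u hu).congr_of_eventuallyEq ?_
      filter_upwards [hIopen.mem_nhds hu] with s hs using hDM s hs
    rw [(hdD.log hDp.ne').deriv]
    have ht := Lag.trace_lemma N (Lag.mom lam α u) (m' u) u (lam + α + 1)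
      (fun k => Lag.mom_euler lam α u k hα hu0) (fun k => c k u) (hrelF u hu)
    rw [mul_div_assoc', div_eq_iff hDp.ne', hDM u hu]
    exact ht
  intro t ht
  have ht0 : 0 < t := hIsub ht
  have e1 : deriv (fun u => u * deriv (fun v => Real.log (D v)) u) t = deriv (c N) t := by
    have : (fun u => u * deriv (fun v => Real.log (D v)) u) =ᶠ[nhds t]
        fun u => (N + 1 : ℝ) * (lam + α + 1 + N) + c N u := by
      filter_upwards [hIopen.mem_nhds ht] with s hs using hH s hs
    rw [this.deriv_eq, deriv_const_add]
  have e2 : ∫ x in Set.Ioi (0 : ℝ), (p (N + 1) t).eval x *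
      ((x + t) ^ lam * x ^ α * Real.exp (-x)) / x
      = Lag.Lf (Lag.mom lam (α - 1) t) (p (N + 1) t) := by
    rw [← Lag.integral_eq_Lf (fun x => (x + t) ^ lam * x ^ (α - 1) * Real.exp (-x))
      (Lag.mom lam (α - 1) t)
      (fun k => Lag.integ lam (α - 1) t k (by linarith) ht0) (fun k => rfl)]
    refine setIntegral_congr_fun measurableSet_Ioi fun x hx => ?_
    have hx : 0 < x := hx
    simp only [Real.rpow_sub_one hx.ne']
    ring
  rw [e1, e2]
  have key := Lag.alg_final N (Lag.mom lam α t) (m' t) (Lag.mom lam (α - 1) t) α (h N t)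
    (hpos N t ht) (fun k => Lag.mom_ibp lam α t k hα ht0)
    (fun k => by rw [Lag.mom_shift, sub_add_cancel])
    (fun k => p k t) (fun k => hmonic k t ht) (fun k => hdeg k t ht)
    (fun j k hjk => by rw [horth' t ht, if_neg hjk])
    (by rw [horth' t ht, if_pos rfl]) (fun k => deriv (c k) t)
    (by
      intro j hj
      have h1 : HasDerivAt (fun u => ∑ k ∈ Finset.range (N + 1),
          Lag.mom lam α u (j + k) * c k u + Lag.mom lam α u (j + (N + 1)))
          (∑ k ∈ Finset.range (N + 1), (m' t (j + k) * c k t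
            + Lag.mom lam α t (j + k) * deriv (c k) t) + m' t (j + (N + 1))) t := by
        refine HasDerivAt.add (HasDerivAt.fun_sum fun k hk => ?_) (hmd t ht _)
        exact (hmd t ht _).mul (hcd t ht k (Finset.mem_range.1 hk)).hasDerivAt
      have h2 : HasDerivAt (fun u => ∑ k ∈ Finset.range (N + 1),
          Lag.mom lam α u (j + k) * c k u + Lag.mom lam α u (j + (N + 1))) 0 t := by
        refine (hasDerivAt_const t (0 : ℝ)).congr_of_eventuallyEq ?_
        filter_upwards [hIopen.mem_nhds ht] with s hs using hrel s hs j hj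
      exact h1.unique h2)
  push_cast
  exact key
end
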